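/- For every d ∈ ℕ and every ℓ ∈ ℕ with either ℓ ≤ 0.1·2^d, or ℓ ≤ 0.315·2^d and d ≥ 13, there exists t ∈ ℕ with the following property: for every finite nonempty A ⊆ ℤ with 2^d·#A ≤ #(A+A) ≤ (2^d+ℓ)·#A, if A is (d,t)-non-degenerate then there exist a set X ⊆ ℤ with #X ≤ ℓ+1 and a d-GAP P ⊆ ℤ with #P ≤ t·#A such that A ⊆ X+P. -/

import Mathlib

open Set Pointwise

/-- `P` is a `d`-dimensional generalized arithmetic progression in `ℤ`:
`P = {∑ i, λ i * a i : 1 ≤ λ i ≤ ℓ i}`. -/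
def IsGAP (d : ℕ) (P : Set ℤ) : Prop :=
  ∃ (a : Fin d → ℤ) (l : Fin d → ℕ), (∀ i, 1 ≤ l i) ∧
    P = {x | ∃ lam : Fin d → ℕ, (∀ i, 1 ≤ lam i ∧ lam i ≤ l i) ∧ x = ∑ i, (lam i : ℤ) * a i}

/-- `A ⊆ ℤ` is `(d,t)`-non-degenerate: there are no finite `X` with `#X ≤ t` and
`(d-1)`-GAP `P` with `A ⊆ X + P` and `#(X+P) ≤ t·#A`. -/
def NonDegenerate (d t : ℕ) (A : Set ℤ) : Prop :=
  ¬ ∃ X P : Set ℤ, X.Finite ∧ X.ncard ≤ t ∧ IsGAP (d - 1) P ∧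
      A ⊆ X + P ∧ (X + P).ncard ≤ t * A.ncard

/-- Reducing a vector modulo the integer multiples of `b` to lie near a given real translate. -/
theorem exists_int_norm_add_zsmul_le {E : Type*} [NormedAddCommGroup E] [NormedSpace ℝ E]
    (y b : E) (s : ℝ) : ∃ j : ℤ, ‖y + j • b‖ ≤ ‖y + s • b‖ + ‖b‖ / 2 := by
  refine ⟨round s, ?_⟩
  have h : y + round s • b = (y + s • b) - (s - round s) • b := by
    rw [sub_smul, Int.cast_smul_eq_zsmul]; abel
  rw [h]
  refine (norm_sub_le _ _).trans ?_
  rw [norm_smul, Real.norm_eq_abs]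
  nlinarith [abs_sub_round s, norm_nonneg b]

/-- An element of `Λ` can be lifted from the quotient by the line through `b ∈ Λ` to an element
of `Λ` whose norm is controlled by the quotient norm. -/
theorem exists_lift_norm_le {E : Type*} [NormedAddCommGroup E] [NormedSpace ℝ E]
    {Λ : AddSubgroup E} {b : E} (hb : b ∈ Λ) {y : E} (hy : y ∈ Λ) {ε : ℝ} (hε : 0 < ε) :
    ∃ z ∈ Λ, (Submodule.span ℝ {b}).mkQ z = (Submodule.span ℝ {b}).mkQ y ∧
      ‖z‖ ≤ ‖(Submodule.span ℝ {b}).mkQ y‖ + ε + ‖b‖ / 2 := by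
  obtain ⟨m, hm, hlt⟩ := Submodule.Quotient.norm_mk_lt ((Submodule.span ℝ {b}).mkQ y) hε
  have hm' : m - y ∈ Submodule.span ℝ {b} := (Submodule.Quotient.eq _).1 hm
  obtain ⟨s, hs⟩ := Submodule.mem_span_singleton.1 hm'
  obtain ⟨j, hj⟩ := exists_int_norm_add_zsmul_le y b s
  refine ⟨y + j • b, Λ.add_mem hy (Λ.zsmul_mem hb j), ?_, ?_⟩
  · have hb0 : (Submodule.span ℝ {b}).mkQ b = 0 :=
      (Submodule.Quotient.mk_eq_zero _).2 (Submodule.mem_span_singleton_self b)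
    rw [map_add, map_zsmul, hb0, smul_zero, add_zero]
  · have : y + s • b = m := by rw [hs]; abel
    rw [this] at hj
    linarith

/-- Discreteness passes to the quotient by the line through a lattice vector. -/
theorem finite_ball_map_mkQ {E : Type*} [NormedAddCommGroup E] [NormedSpace ℝ E]
    {Λ : AddSubgroup E} (hΛ : ∀ R : ℝ, {x | x ∈ Λ ∧ ‖x‖ ≤ R}.Finite) {b : E} (hb : b ∈ Λ) (R : ℝ) :
    {x | x ∈ Λ.map (Submodule.span ℝ {b}).mkQ.toAddMonoidHom ∧ ‖x‖ ≤ R}.Finite := by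
  refine ((hΛ (R + 1 + ‖b‖ / 2)).image (Submodule.span ℝ {b}).mkQ).subset ?_
  rintro x ⟨⟨y, hy, rfl⟩, hxR⟩
  obtain ⟨z, hz, hzy, hzn⟩ := exists_lift_norm_le hb hy one_pos
  refine ⟨z, ⟨hz, hzn.trans ?_⟩, hzy⟩
  have : ‖(Submodule.span ℝ {b}).mkQ y‖ ≤ R := hxR
  linarith

theorem exists_shortest {E : Type*} [NormedAddCommGroup E]
    {Λ : AddSubgroup E} (hΛ : ∀ R : ℝ, {x | x ∈ Λ ∧ ‖x‖ ≤ R}.Finite)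
    (h0 : ∃ x ∈ Λ, x ≠ 0) : ∃ b ∈ Λ, b ≠ 0 ∧ ∀ x ∈ Λ, x ≠ 0 → ‖b‖ ≤ ‖x‖ := by
  obtain ⟨x, hx, hx0⟩ := h0
  have hfin : {y | y ∈ Λ ∧ ‖y‖ ≤ ‖x‖ ∧ y ≠ 0}.Finite :=
    (hΛ ‖x‖).subset fun y hy => ⟨hy.1, hy.2.1⟩
  obtain ⟨b, hb, hmin⟩ := hfin.exists_minimalFor (fun y => ‖y‖) _ ⟨x, hx, le_rfl, hx0⟩
  refine ⟨b, hb.1, hb.2.2, fun y hy hy0 => ?_⟩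
  by_contra! hlt
  exact absurd (hmin ⟨hy, hlt.le.trans hb.2.1, hy0⟩ hlt.le) (not_le.2 hlt)

theorem finrank_quotient_span_singleton {E : Type*} [AddCommGroup E] [Module ℝ E]
    [FiniteDimensional ℝ E] {b : E} (hb : b ≠ 0) {r : ℕ} (hr : Module.finrank ℝ E = r + 1) :
    Module.finrank ℝ (E ⧸ Submodule.span ℝ {b}) = r := by
  have := Submodule.finrank_quotient_add_finrank (Submodule.span ℝ {b})
  rw [finrank_span_singleton hb] at this
  omega

/-- Every discrete subgroup of a normed space of dimension `r` is spanned by `r` vectors whose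
coefficients are controlled by the norm. -/
theorem exists_reduced_basis (r : ℕ) : ∃ C : ℝ, 1 ≤ C ∧
    ∀ (E : Type) [NormedAddCommGroup E] [NormedSpace ℝ E] [FiniteDimensional ℝ E],
    Module.finrank ℝ E = r → ∀ Λ : AddSubgroup E, (∀ R : ℝ, {x | x ∈ Λ ∧ ‖x‖ ≤ R}.Finite) →
    ∃ b : Fin r → E, (∀ i, b i ∈ Λ) ∧ (∀ x ∈ Λ, ∃ n : Fin r → ℤ, x = ∑ i, n i • b i) ∧
      ∀ (n : Fin r → ℤ) (i : Fin r), |(n i : ℝ)| * ‖b i‖ ≤ C * ‖∑ j, n j • b j‖ := by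
  induction r with
  | zero =>
    refine ⟨1, le_rfl, fun E _ _ _ hE Λ hΛ => ⟨Fin.elim0, fun i => i.elim0, fun x _ => ?_,
      fun n i => i.elim0⟩⟩
    have := Module.finrank_zero_iff.1 hE
    exact ⟨0, Subsingleton.elim _ _⟩
  | succ r ih =>
    obtain ⟨C, hC, ih⟩ := ih
    refine ⟨1 + 2 * C * (r + 1), by nlinarith [(Nat.cast_nonneg r : (0 : ℝ) ≤ r)],
      fun E _ _ _ hE Λ hΛ => ?_⟩
    by_cases h0 : ∃ x ∈ Λ, x ≠ 0
    swap
    · push Not at h0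
      exact ⟨0, fun i => Λ.zero_mem, fun x hx => ⟨0, by simp [h0 x hx]⟩, fun n i => by simp⟩
    obtain ⟨b₀, hb₀, hb₀0, hmin⟩ := exists_shortest hΛ h0
    have hpos : 0 < ‖b₀‖ := norm_pos_iff.2 hb₀0
    set S := Submodule.span ℝ {b₀} with hS
    have hclosed : IsClosed (S : Set E) := Submodule.closed_of_finiteDimensional S
    obtain ⟨c, hcΛ, hcspan, hcn⟩ := ih (E ⧸ S) (finrank_quotient_span_singleton hb₀0 hE)
      (Λ.map S.mkQ.toAddMonoidHom) (finite_ball_map_mkQ hΛ hb₀)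
    have hlift : ∀ i, ∃ z ∈ Λ, S.mkQ z = c i ∧ ‖z‖ ≤ 2 * ‖c i‖ := by
      intro i
      by_cases hci : c i = 0
      · exact ⟨0, Λ.zero_mem, by simp [hci], by simp⟩
      obtain ⟨y, hy, hyc⟩ := hcΛ i
      change S.mkQ y = c i at hyc
      have hlarge : ‖b₀‖ / 2 ≤ ‖c i‖ := by
        by_contra! hlt
        obtain ⟨z, hz, hzy, hzn⟩ := exists_lift_norm_le hb₀ hy (half_pos (sub_pos.2 hlt))
        rw [← hS, hyc] at hzn hzy
        have hz0 : z ≠ 0 := by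
          rintro rfl
          exact hci (by rw [← hzy, map_zero])
        have := hmin z hz hz0
        linarith
      have hfin : {z | z ∈ Λ ∧ ‖z‖ ≤ ‖c i‖ + 1 + ‖b₀‖ / 2 ∧ S.mkQ z = c i}.Finite :=
        (hΛ (‖c i‖ + 1 + ‖b₀‖ / 2)).subset fun y hy => ⟨hy.1, hy.2.1⟩
      obtain ⟨z₁, hz₁, hz₁y, hz₁n⟩ := exists_lift_norm_le hb₀ hy one_pos
      rw [← hS, hyc] at hz₁n hz₁y
      obtain ⟨z, hz, hzmin⟩ := hfin.exists_minimalFor (fun y => ‖y‖) _ ⟨z₁, hz₁, hz₁n, hz₁y⟩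
      refine ⟨z, hz.1, hz.2.2, le_of_forall_pos_le_add fun ε hε => ?_⟩
      obtain ⟨w, hw, hwy, hwn⟩ := exists_lift_norm_le hb₀ hy (lt_min hε one_pos)
      rw [← hS, hyc] at hwn hwy
      have hzw : ‖z‖ ≤ ‖w‖ := by
        by_contra! hlt
        have : ‖w‖ ≤ ‖c i‖ + 1 + ‖b₀‖ / 2 := hwn.trans (by gcongr; exact min_le_right _ _)
        exact absurd (hzmin ⟨hw, this, hwy⟩ hlt.le) (not_le.2 hlt)
      linarith [min_le_left ε 1]
    choose z hzΛ hzc hzn using hlift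
    have hsum : ∀ n : Fin r → ℤ, S.mkQ (∑ i, n i • z i) = ∑ i, n i • c i := by
      intro n
      simp only [map_sum, map_zsmul, hzc]
    refine ⟨Fin.cons b₀ z, ?_, ?_, ?_⟩
    · intro i
      refine Fin.cases hb₀ (fun j => ?_) i
      simpa using hzΛ j
    · intro x hx
      obtain ⟨n, hn⟩ := hcspan (S.mkQ x) ⟨x, hx, rfl⟩
      rw [← hsum] at hn
      have hmem : x - ∑ i, n i • z i ∈ S := (Submodule.Quotient.eq _).1 hn
      obtain ⟨s, hs⟩ := Submodule.mem_span_singleton.1 hmem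
      have hxΛ : x - ∑ i, n i • z i ∈ Λ :=
        Λ.sub_mem hx (Λ.sum_mem fun i _ => Λ.zsmul_mem (hzΛ i) _)
      have hfr : x - ∑ i, n i • z i - round s • b₀ = 0 := by
        by_contra hne
        have hmem' := Λ.sub_mem hxΛ (Λ.zsmul_mem hb₀ (round s))
        have h1 := hmin _ hmem' hne
        have h2 : x - ∑ i, n i • z i - round s • b₀ = (s - round s) • b₀ := by
          rw [← hs, sub_smul, Int.cast_smul_eq_zsmul]
        rw [h2, norm_smul, Real.norm_eq_abs] at h1
        nlinarith [abs_sub_round s]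
      refine ⟨Fin.cons (round s) n, ?_⟩
      rw [Fin.sum_univ_succ]
      simp only [Fin.cons_zero, Fin.cons_succ]
      rw [sub_sub, sub_eq_zero] at hfr
      rw [hfr]; abel
    · intro n
      set x := ∑ j, n j • (Fin.cons b₀ z : Fin (r + 1) → E) j with hx
      have hx' : x = n 0 • b₀ + ∑ j : Fin r, n j.succ • z j := by
        rw [hx, Fin.sum_univ_succ]; simp
      have hb0q : S.mkQ b₀ = 0 :=
        (Submodule.Quotient.mk_eq_zero _).2 (Submodule.mem_span_singleton_self b₀)
      have hxq : S.mkQ x = ∑ j : Fin r, n j.succ • c j := by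
        rw [hx', map_add, map_zsmul, hb0q, hsum (fun j => n j.succ)]; simp
      have hxle : ‖∑ j : Fin r, n j.succ • c j‖ ≤ ‖x‖ := by
        rw [← hxq]; exact Submodule.Quotient.norm_mk_le _ x
      have hsucc : ∀ j : Fin r, |(n j.succ : ℝ)| * ‖z j‖ ≤ 2 * C * ‖x‖ := by
        intro j
        calc |(n j.succ : ℝ)| * ‖z j‖ ≤ |(n j.succ : ℝ)| * (2 * ‖c j‖) := by gcongr; exact hzn j
          _ = 2 * (|(n j.succ : ℝ)| * ‖c j‖) := by ring
          _ ≤ 2 * (C * ‖x‖) := by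
            refine mul_le_mul_of_nonneg_left ?_ zero_le_two
            exact (hcn (fun j => n j.succ) j).trans (by gcongr)
          _ = _ := by ring
      have hr0 : (0 : ℝ) ≤ r := Nat.cast_nonneg r
      have hxn := norm_nonneg x
      intro i
      refine Fin.cases ?_ (fun j => ?_) i
      · simp only [Fin.cons_zero]
        have h1 : n 0 • b₀ = x - ∑ j : Fin r, n j.succ • z j := by rw [hx']; abel
        have h2 : |(n 0 : ℝ)| * ‖b₀‖ = ‖n 0 • b₀‖ := by
          rw [← Int.cast_smul_eq_zsmul ℝ, norm_smul, Real.norm_eq_abs]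
        have h3 : ‖∑ j : Fin r, n j.succ • z j‖ ≤ r * (2 * C * ‖x‖) := by
          refine (norm_sum_le _ _).trans ?_
          refine (Finset.sum_le_card_nsmul _ _ (2 * C * ‖x‖) fun j _ => ?_).trans ?_
          · rw [← Int.cast_smul_eq_zsmul ℝ, norm_smul, Real.norm_eq_abs]
            exact hsucc j
          · simp
        rw [h2, h1]
        refine (norm_sub_le _ _).trans ?_
        nlinarith [mul_nonneg (by linarith : (0 : ℝ) ≤ C) hxn]
      · simp only [Fin.cons_succ]
        refine (hsucc j).trans ?_
        nlinarith [mul_nonneg (by linarith : (0 : ℝ) ≤ C) hxn,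
          mul_nonneg hr0 (mul_nonneg (by linarith : (0 : ℝ) ≤ C) hxn)]

/-- The lattice points in a ball are sandwiched between a box in suitable coordinates and the
lattice points of a dilated ball. -/
theorem exists_lattice_box (r : ℕ) : ∃ C : ℝ, 1 ≤ C ∧
    ∀ (E : Type) [NormedAddCommGroup E] [NormedSpace ℝ E] [FiniteDimensional ℝ E],
    Module.finrank ℝ E = r → ∀ Λ : AddSubgroup E, (∀ R : ℝ, {x | x ∈ Λ ∧ ‖x‖ ≤ R}.Finite) →
    ∀ R : ℝ, 0 < R → ∃ (b : Fin r → E) (L : Fin r → ℕ), (∀ i, b i ∈ Λ) ∧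
      (∀ x ∈ Λ, ‖x‖ ≤ R → ∃ n : Fin r → ℤ, (∀ i, |n i| ≤ L i) ∧ x = ∑ i, n i • b i) ∧
      (∀ n : Fin r → ℤ, (∀ i, |n i| ≤ L i) → ‖∑ i, n i • b i‖ ≤ C * R) ∧
      (∀ n m : Fin r → ℤ, (∀ i, |n i| ≤ L i) → (∀ i, |m i| ≤ L i) →
        ∑ i, n i • b i = ∑ i, m i • b i → n = m) := by
  classical
  obtain ⟨C, hC, hbasis⟩ := exists_reduced_basis r
  refine ⟨(r + 1) * C, by nlinarith [(Nat.cast_nonneg r : (0 : ℝ) ≤ r)],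
    fun E _ _ _ hE Λ hΛ R hR => ?_⟩
  obtain ⟨b, hb, hspan, hbd⟩ := hbasis E hE Λ hΛ
  have hCR : 0 ≤ C * R := by nlinarith
  refine ⟨b, fun i => ⌊C * R / ‖b i‖⌋₊, hb, fun x hx hxR => ?_, fun n hn => ?_,
    fun n m hn hm hnm => ?_⟩
  · obtain ⟨n, rfl⟩ := hspan x hx
    refine ⟨fun i => if b i = 0 then 0 else n i, fun i => ?_, ?_⟩
    · by_cases hi : b i = 0
      · simp [hi]
      · simp only [hi, if_false]
        have hpos : 0 < ‖b i‖ := norm_pos_iff.2 hi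
        have h1 : |(n i : ℝ)| ≤ C * R / ‖b i‖ := by
          rw [le_div_iff₀ hpos]
          exact (hbd n i).trans (by gcongr)
        rw [Int.abs_eq_natAbs]
        refine Nat.cast_le.2 (Nat.le_floor ?_)
        rwa [Nat.cast_natAbs, Int.cast_abs]
    · refine Finset.sum_congr rfl fun i _ => ?_
      by_cases hi : b i = 0 <;> simp [hi]
  · have hterm : ∀ i, ‖n i • b i‖ ≤ C * R := by
      intro i
      by_cases hi : b i = 0
      · simpa [hi] using hCR
      have hpos : 0 < ‖b i‖ := norm_pos_iff.2 hi
      rw [← Int.cast_smul_eq_zsmul ℝ, norm_smul, Real.norm_eq_abs, ← le_div_iff₀ hpos]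
      have h1 : (|n i| : ℝ) ≤ (⌊C * R / ‖b i‖⌋₊ : ℝ) := by exact_mod_cast hn i
      exact h1.trans (Nat.floor_le (by positivity))
    refine (norm_sum_le _ _).trans ((Finset.sum_le_card_nsmul _ _ _ fun i _ => hterm i).trans ?_)
    simp only [Finset.card_univ, Fintype.card_fin, nsmul_eq_mul]
    nlinarith
  · funext i
    by_cases hi : b i = 0
    · have h1 := hn i
      have h2 := hm i
      simp only [hi, norm_zero, div_zero, Nat.floor_zero, Nat.cast_zero, abs_nonpos_iff] at h1 h2
      rw [h1, h2]
    · have h := hbd (n - m) i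
      have h0 : ∑ j, (n - m) j • b j = 0 := by
        simp only [Pi.sub_apply, sub_smul, Finset.sum_sub_distrib, hnm, sub_self]
      rw [h0, norm_zero, mul_zero] at h
      have hpos : 0 < ‖b i‖ := norm_pos_iff.2 hi
      have h2 : |((n - m) i : ℝ)| ≤ 0 := by
        by_contra! hlt
        nlinarith [mul_pos hlt hpos]
      have h3 : ((n - m) i : ℝ) = 0 := abs_nonpos_iff.1 h2
      have h4 : (n - m) i = 0 := by exact_mod_cast h3
      simpa [sub_eq_zero] using h4

/-- The integer box with side half-lengths `L`. -/
noncomputable def intBox {M : ℕ} (L : Fin M → ℕ) : Finset (Fin M → ℤ) :=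
  Fintype.piFinset fun i => Finset.Icc (-(L i : ℤ)) (L i)

theorem mem_intBox {M : ℕ} {L : Fin M → ℕ} {n : Fin M → ℤ} :
    n ∈ intBox L ↔ ∀ i, |n i| ≤ L i := by
  simp [intBox, abs_le]

theorem card_intBox {M : ℕ} (L : Fin M → ℕ) : (intBox L).card = ∏ i, (2 * L i + 1) := by
  rw [intBox, Fintype.card_piFinset]
  refine Finset.prod_congr rfl fun i _ => ?_
  rw [Int.card_Icc]; omega

/-- Integer vectors, rescaled so that the box with side half-lengths `L` has norm at most one. -/
noncomputable def scaledEmb {M : ℕ} (L : Fin M → ℕ) : (Fin M → ℤ) →+ (Fin M → ℝ) where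
  toFun n i := (n i : ℝ) / (2 * L i + 1)
  map_zero' := by ext; simp
  map_add' m n := by ext; simp [add_div]

theorem norm_scaledEmb_le_iff {M : ℕ} (L : Fin M → ℕ) (n : Fin M → ℤ) {R : ℝ} (hR : 0 ≤ R) :
    ‖scaledEmb L n‖ ≤ R ↔ ∀ i, |(n i : ℝ)| ≤ R * (2 * L i + 1) := by
  rw [pi_norm_le_iff_of_nonneg hR]
  refine forall_congr' fun i => ?_
  have hpos : (0 : ℝ) < 2 * L i + 1 := by positivity
  change ‖(n i : ℝ) / (2 * L i + 1)‖ ≤ R ↔ _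
  rw [Real.norm_eq_abs, abs_div, abs_of_pos hpos, div_le_iff₀ hpos]

theorem mem_intBox_of_norm_scaledEmb_le {M : ℕ} (L : Fin M → ℕ) (n : Fin M → ℤ) {Q : ℕ}
    (h : ‖scaledEmb L n‖ ≤ Q) : n ∈ intBox fun i => Q * (2 * L i + 1) := by
  rw [mem_intBox]
  intro i
  have := (norm_scaledEmb_le_iff L n (Nat.cast_nonneg Q)).1 h i
  exact_mod_cast this

theorem finite_ball_range_scaledEmb {M : ℕ} (L : Fin M → ℕ) (R : ℝ) :
    {x | x ∈ (scaledEmb L).range ∧ ‖x‖ ≤ R}.Finite := by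
  obtain ⟨Q, hQ⟩ := exists_nat_ge R
  refine ((intBox fun i => Q * (2 * L i + 1)).finite_toSet.image (scaledEmb L)).subset ?_
  rintro x ⟨⟨n, rfl⟩, hn⟩
  exact ⟨n, mem_intBox_of_norm_scaledEmb_le L n (hn.trans hQ), rfl⟩

/-- A generalized arithmetic progression with a short relation among its generators is contained
in one of smaller dimension and comparable size. -/
theorem exists_box_of_relation (M T : ℕ) : ∃ C : ℕ, ∀ (a : Fin (M + 1) → ℤ) (L : Fin (M + 1) → ℕ)
    (v : Fin (M + 1) → ℤ), v ≠ 0 → (∀ i, |v i| ≤ T * L i) → ∑ i, v i * a i = 0 →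
    ∃ (a' : Fin M → ℤ) (L' : Fin M → ℕ),
      (∀ n ∈ intBox L, ∃ n' ∈ intBox L', ∑ i, n i * a i = ∑ j, n' j * a' j) ∧
      ∏ j, (2 * L' j + 1) ≤ C * ∏ i, (2 * L i + 1) := by
  obtain ⟨C, hC, hbox⟩ := exists_lattice_box M
  obtain ⟨Q, hQ⟩ := exists_nat_ge (C + 1 + T / 2)
  refine ⟨(2 * Q + 1) ^ (M + 1), fun a L v hv0 hvT hva => ?_⟩
  set w := scaledEmb L v with hw
  have hwΛ : w ∈ (scaledEmb L).range := ⟨v, rfl⟩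
  have hpos : ∀ i, (0 : ℝ) < 2 * L i + 1 := fun i => by positivity
  have hw0 : w ≠ 0 := by
    intro h
    refine hv0 (funext fun i => ?_)
    have := congrFun h i
    change (v i : ℝ) / (2 * L i + 1) = 0 at this
    rw [div_eq_zero_iff, or_iff_left (hpos i).ne'] at this
    exact_mod_cast this
  have hwT : ‖w‖ ≤ T := by
    rw [hw, norm_scaledEmb_le_iff L v (Nat.cast_nonneg T)]
    intro i
    have h1 : (|v i| : ℝ) ≤ T * L i := by exact_mod_cast hvT i
    refine h1.trans ?_
    have : (0 : ℝ) ≤ T := Nat.cast_nonneg T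
    nlinarith [mul_nonneg this (Nat.cast_nonneg (α := ℝ) (L i))]
  set S := Submodule.span ℝ {w} with hS
  have hclosed : IsClosed (S : Set (Fin (M + 1) → ℝ)) := Submodule.closed_of_finiteDimensional S
  obtain ⟨b, L', hbΛ, hcover, hnorm, hinj⟩ := hbox ((Fin (M + 1) → ℝ) ⧸ S)
    (finrank_quotient_span_singleton hw0 (by simp)) ((scaledEmb L).range.map S.mkQ.toAddMonoidHom)
    (finite_ball_map_mkQ (finite_ball_range_scaledEmb L) hwΛ) 1 one_pos
  have hβ : ∀ j, ∃ β : Fin (M + 1) → ℤ, S.mkQ (scaledEmb L β) = b j := by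
    intro j
    obtain ⟨_, ⟨β, rfl⟩, h⟩ := hbΛ j
    exact ⟨β, h⟩
  choose β hβ using hβ
  have hsum : ∀ n' : Fin M → ℤ, S.mkQ (scaledEmb L (∑ j, n' j • β j)) = ∑ j, n' j • b j := by
    intro n'
    simp only [map_sum, map_zsmul, hβ]
  refine ⟨fun j => ∑ i, β j i * a i, L', fun n hn => ?_, ?_⟩
  · have hn1 : ‖S.mkQ (scaledEmb L n)‖ ≤ 1 := by
      refine (Submodule.Quotient.norm_mk_le S _).trans ?_
      rw [norm_scaledEmb_le_iff L n zero_le_one]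
      intro i
      have h1 : (|n i| : ℝ) ≤ L i := by exact_mod_cast mem_intBox.1 hn i
      have := Nat.cast_nonneg (α := ℝ) (L i)
      linarith
    obtain ⟨n', hn', heq⟩ := hcover _ ⟨_, ⟨n, rfl⟩, rfl⟩ hn1
    refine ⟨n', mem_intBox.2 hn', ?_⟩
    rw [← hsum] at heq
    have hmem : scaledEmb L n - scaledEmb L (∑ j, n' j • β j) ∈ S :=
      (Submodule.Quotient.eq _).1 heq
    obtain ⟨s, hs⟩ := Submodule.mem_span_singleton.1 hmem
    rw [← map_sub] at hs
    have hcoord : ∀ i, (((n - ∑ j, n' j • β j) i : ℤ) : ℝ) = s * v i := by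
      intro i
      have h1 := congrFun hs i
      change s * ((v i : ℝ) / (2 * L i + 1)) =
        (((n - ∑ j, n' j • β j) i : ℤ) : ℝ) / (2 * L i + 1) at h1
      field_simp [(hpos i).ne'] at h1
      exact h1.symm
    have hzero : ∑ i, (n - ∑ j, n' j • β j) i * a i = 0 := by
      have : ((∑ i, (n - ∑ j, n' j • β j) i * a i : ℤ) : ℝ) = s * ((∑ i, v i * a i : ℤ) : ℝ) := by
        push_cast [Finset.mul_sum]
        refine Finset.sum_congr rfl fun i _ => ?_
        rw [← mul_assoc, ← hcoord i]
      rw [hva, Int.cast_zero, mul_zero] at this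
      exact_mod_cast this
    simp only [Pi.sub_apply, Finset.sum_apply, Pi.smul_apply, smul_eq_mul, sub_mul,
      Finset.sum_sub_distrib, sub_eq_zero] at hzero
    rw [hzero]
    simp only [Finset.sum_mul, Finset.mul_sum, mul_assoc]
    exact Finset.sum_comm
  · have hlift : ∀ n' : Fin M → ℤ, ∃ m : Fin (M + 1) → ℤ, n' ∈ intBox L' →
        m ∈ (intBox fun i => Q * (2 * L i + 1)) ∧ S.mkQ (scaledEmb L m) = ∑ j, n' j • b j := by
      intro n'
      by_cases hn' : n' ∈ intBox L'
      swap
      · exact ⟨0, fun h => absurd h hn'⟩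
      obtain ⟨z, ⟨m, rfl⟩, hz, hzn⟩ := exists_lift_norm_le hwΛ
        (⟨_, rfl⟩ : scaledEmb L (∑ j, n' j • β j) ∈ (scaledEmb L).range) one_pos
      rw [← hS, hsum] at hz hzn
      refine ⟨m, fun _ => ⟨mem_intBox_of_norm_scaledEmb_le L m (hzn.trans (le_trans ?_ hQ)), hz⟩⟩
      have := hnorm n' (mem_intBox.1 hn')
      linarith
    choose f hf using hlift
    have hcard := Finset.card_le_card_of_injOn f (s := intBox L')
      (t := intBox fun i => Q * (2 * L i + 1)) (fun n' hn' => (hf n' hn').1) (by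
        intro n' hn' m' hm' h
        refine hinj n' m' (mem_intBox.1 hn') (mem_intBox.1 hm') ?_
        rw [← (hf n' hn').2, ← (hf m' hm').2, h])
    rw [card_intBox, card_intBox] at hcard
    refine hcard.trans ?_
    have h2 : ((2 * Q + 1) ^ (M + 1)) * ∏ i, (2 * L i + 1)
        = ∏ i : Fin (M + 1), ((2 * Q + 1) * (2 * L i + 1)) := by
      rw [Finset.prod_mul_distrib]; simp
    rw [h2]
    refine Finset.prod_le_prod' fun i _ => ?_
    nlinarith

/-- A set covered by a generalized arithmetic progression of size comparable to its own is covered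
by one which is moreover proper up to dilation by `T`. -/
theorem exists_proper_cover (M T : ℕ) : ∀ C : ℕ, ∃ C' : ℕ, ∀ (A : Finset ℤ) (a : Fin M → ℤ)
    (L : Fin M → ℕ), (∀ x ∈ A, ∃ n ∈ intBox L, x = ∑ i, n i * a i) →
    ∏ i, (2 * L i + 1) ≤ C * A.card →
    ∃ (a' : Fin M → ℤ) (L' : Fin M → ℕ), (∀ x ∈ A, ∃ n ∈ intBox L', x = ∑ i, n i * a' i) ∧
      ∏ i, (2 * L' i + 1) ≤ C' * A.card ∧
      ∀ v : Fin M → ℤ, (∀ i, |v i| ≤ T * L' i) → ∑ i, v i * a' i = 0 → v = 0 := by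
  induction M with
  | zero =>
    exact fun C => ⟨C, fun A a L hA hL => ⟨a, L, hA, hL, fun v _ _ => Subsingleton.elim _ _⟩⟩
  | succ M ih =>
    intro C
    obtain ⟨D, hD⟩ := exists_box_of_relation M T
    obtain ⟨C', hC'⟩ := ih (D * C)
    refine ⟨max C C', fun A a L hA hL => ?_⟩
    by_cases hprop : ∀ v : Fin (M + 1) → ℤ, (∀ i, |v i| ≤ T * L i) → ∑ i, v i * a i = 0 → v = 0
    · exact ⟨a, L, hA, hL.trans (Nat.mul_le_mul_right _ (le_max_left _ _)), hprop⟩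
    push Not at hprop
    obtain ⟨v, hvT, hva, hv0⟩ := hprop
    obtain ⟨a₁, L₁, hcov, hcard⟩ := hD a L v hv0 hvT hva
    obtain ⟨a₂, L₂, hcov₂, hcard₂, hprop₂⟩ := hC' A a₁ L₁ (by
        intro x hx
        obtain ⟨n, hn, rfl⟩ := hA x hx
        exact hcov n hn) (hcard.trans (by rw [mul_assoc]; exact Nat.mul_le_mul_left _ hL))
    refine ⟨Fin.cons 0 a₂, Fin.cons 0 L₂, fun x hx => ?_, ?_, fun v hv hsum => ?_⟩
    · obtain ⟨n, hn, rfl⟩ := hcov₂ x hx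
      refine ⟨Fin.cons 0 n, mem_intBox.2 (Fin.cases (by simp) fun i => ?_),
        by simp [Fin.sum_univ_succ]⟩
      simpa using mem_intBox.1 hn i
    · rw [Fin.prod_univ_succ]
      simpa using hcard₂.trans (Nat.mul_le_mul_right _ (le_max_right _ _))
    · rw [Fin.sum_univ_succ] at hsum
      have h0 : v 0 = 0 := by simpa using hv 0
      have hs := hprop₂ (fun i => v i.succ) (fun i => by simpa using hv i.succ)
        (by simpa using hsum)
      exact funext (Fin.cases h0 fun i => congrFun hs i)

/-- A weighted Cauchy-Davenport inequality, obtained from the unweighted one on level sets. -/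
theorem sum_add_sum_sub_le_sum_add {H : Type*} [AddCommGroup H] [IsAddTorsionFree H]
    [DecidableEq H] (N : ℕ) : ∀ (S T : Finset H) (u u' w : H → ℝ) (c : ℝ),
    S.card + T.card ≤ N → (∀ x ∈ S, 0 ≤ u x ∧ u x ≤ c) → (∀ y ∈ T, 0 ≤ u' y ∧ u' y ≤ c) →
    (∃ x ∈ S, u x = c) → (∃ y ∈ T, u' y = c) →
    (∀ x ∈ S, ∀ y ∈ T, min (u x) (u' y) ≤ w (x + y)) →
    ∑ x ∈ S, u x + ∑ y ∈ T, u' y - c ≤ ∑ s ∈ S + T, w s := by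
  induction N with
  | zero =>
    intro S T u u' w c hN _ _ hS
    obtain ⟨x, hx, _⟩ := hS
    have := Finset.card_pos.2 ⟨x, hx⟩
    omega
  | succ N ih =>
    intro S T u u' w c hN hu hu' hS hT hw
    obtain ⟨x₀, hx₀, hx₀c⟩ := hS
    obtain ⟨y₀, hy₀, hy₀c⟩ := hT
    obtain ⟨x₁, hx₁, hx₁m⟩ := S.exists_min_image u ⟨x₀, hx₀⟩
    obtain ⟨y₁, hy₁, hy₁m⟩ := T.exists_min_image u' ⟨y₀, hy₀⟩
    set m := min (u x₁) (u' y₁) with hm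
    have hum : ∀ x ∈ S, m ≤ u x := fun x hx => (min_le_left _ _).trans (hx₁m x hx)
    have hum' : ∀ y ∈ T, m ≤ u' y := fun y hy => (min_le_right _ _).trans (hy₁m y hy)
    have hm0 : 0 ≤ m := le_min (hu _ hx₁).1 (hu' _ hy₁).1
    have hwm : ∀ s ∈ S + T, m ≤ w s := by
      intro s hs
      obtain ⟨x, hx, y, hy, rfl⟩ := Finset.mem_add.1 hs
      exact (le_min (hum x hx) (hum' y hy)).trans (hw x hx y hy)
    have hcd : (S.card : ℝ) + T.card - 1 ≤ (S + T).card := by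
      have h := cauchy_davenport_of_isAddTorsionFree (s := S) (t := T) ⟨x₀, hx₀⟩ ⟨y₀, hy₀⟩
      have h' : S.card + T.card ≤ (S + T).card + 1 := by omega
      have h'' : (S.card : ℝ) + T.card ≤ (S + T).card + 1 := by exact_mod_cast h'
      linarith
    have hshift : ∀ (U : Finset H) (f : H → ℝ), ∑ x ∈ U, f x = ∑ x ∈ U, (f x - m) + U.card * m := by
      intro U f
      rw [Finset.sum_sub_distrib]; simp
    rw [hshift S, hshift T, hshift (S + T)]
    suffices h : ∑ x ∈ S, (u x - m) + ∑ y ∈ T, (u' y - m) - (c - m) ≤ ∑ s ∈ S + T, (w s - m) by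
      nlinarith
    have hmc : m ≤ c := (hum x₀ hx₀).trans hx₀c.le
    rcases hmc.eq_or_lt with hmc | hmc
    · have h1 : ∑ x ∈ S, (u x - m) ≤ 0 :=
        Finset.sum_nonpos fun x hx => by linarith [(hu x hx).2]
      have h2 : ∑ y ∈ T, (u' y - m) ≤ 0 :=
        Finset.sum_nonpos fun y hy => by linarith [(hu' y hy).2]
      have h3 : 0 ≤ ∑ s ∈ S + T, (w s - m) :=
        Finset.sum_nonneg fun s hs => by linarith [hwm s hs]
      linarith
    set S₁ := S.filter fun x => m < u x
    set T₁ := T.filter fun y => m < u' y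
    have hS₁ : S₁ ⊆ S := Finset.filter_subset _ _
    have hT₁ : T₁ ⊆ T := Finset.filter_subset _ _
    have hcard : S₁.card + T₁.card ≤ N := by
      have hlt : S₁.card + T₁.card < S.card + T.card := by
        rcases min_choice (u x₁) (u' y₁) with h | h
        · refine add_lt_add_of_lt_of_le (Finset.card_lt_card ?_) (Finset.card_le_card hT₁)
          refine Finset.filter_ssubset.2 ⟨x₁, hx₁, ?_⟩
          rw [hm, h]; exact lt_irrefl _
        · refine add_lt_add_of_le_of_lt (Finset.card_le_card hS₁) (Finset.card_lt_card ?_)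
          refine Finset.filter_ssubset.2 ⟨y₁, hy₁, ?_⟩
          rw [hm, h]; exact lt_irrefl _
      omega
    have key := ih S₁ T₁ (fun x => u x - m) (fun y => u' y - m) (fun s => w s - m) (c - m) hcard
      (fun x hx => ⟨by linarith [hum x (hS₁ hx)], by linarith [(hu x (hS₁ hx)).2]⟩)
      (fun y hy => ⟨by linarith [hum' y (hT₁ hy)], by linarith [(hu' y (hT₁ hy)).2]⟩)
      ⟨x₀, Finset.mem_filter.2 ⟨hx₀, by linarith⟩, by simp [hx₀c]⟩
      ⟨y₀, Finset.mem_filter.2 ⟨hy₀, by linarith⟩, by simp [hy₀c]⟩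
      (fun x hx y hy => by
        rw [min_sub_sub_right]
        linarith [hw x (hS₁ hx) y (hT₁ hy)])
    have e1 : ∑ x ∈ S₁, (u x - m) = ∑ x ∈ S, (u x - m) := by
      refine Finset.sum_subset hS₁ fun x hx hx' => ?_
      have : ¬ m < u x := fun h => hx' (Finset.mem_filter.2 ⟨hx, h⟩)
      linarith [hum x hx]
    have e2 : ∑ y ∈ T₁, (u' y - m) = ∑ y ∈ T, (u' y - m) := by
      refine Finset.sum_subset hT₁ fun y hy hy' => ?_
      have : ¬ m < u' y := fun h => hy' (Finset.mem_filter.2 ⟨hy, h⟩)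
      linarith [hum' y hy]
    have e3 : ∑ s ∈ S₁ + T₁, (w s - m) ≤ ∑ s ∈ S + T, (w s - m) :=
      Finset.sum_le_sum_of_subset_of_nonneg (Finset.add_subset_add hS₁ hT₁)
        fun s hs _ => by linarith [hwm s hs]
    linarith

/-- The fibre of `A` above `x` under `π`. -/
def fib {G H : Type*} [DecidableEq H] (π : G → H) (A : Finset G) (x : H) : Finset G :=
  A.filter fun a => π a = x

theorem mem_fib {G H : Type*} [DecidableEq H] {π : G → H} {A : Finset G} {x : H} {a : G} :
    a ∈ fib π A x ↔ a ∈ A ∧ π a = x := Finset.mem_filter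

theorem fib_nonempty {G H : Type*} [DecidableEq H] {π : G → H} {A : Finset G} {x : H}
    (hx : x ∈ A.image π) : (fib π A x).Nonempty := by
  obtain ⟨a, ha, rfl⟩ := Finset.mem_image.1 hx
  exact ⟨a, mem_fib.2 ⟨ha, rfl⟩⟩

theorem sum_card_fib {G H : Type*} [DecidableEq H] {π : G → H} {A : Finset G} {U : Finset H}
    (hU : ∀ a ∈ A, π a ∈ U) : ∑ x ∈ U, ((fib π A x).card : ℝ) = A.card := by
  rw [Finset.card_eq_sum_card_fiberwise (f := π) (t := U) hU]
  push_cast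
  rfl

theorem fib_add_fib_subset {G H : Type*} [AddCommGroup G] [AddCommGroup H] [DecidableEq G]
    [DecidableEq H] (π : G →+ H) (A B : Finset G) (x y : H) :
    fib π A x + fib π B y ⊆ fib π (A + B) (x + y) := by
  intro z hz
  obtain ⟨a, ha, b, hb, rfl⟩ := Finset.mem_add.1 hz
  rw [mem_fib] at ha hb ⊢
  exact ⟨Finset.add_mem_add ha.1 hb.1, by rw [map_add, ha.2, hb.2]⟩

/-- Lower bound for a sumset from lower bounds for the sums of its fibres. -/
theorem sumset_lower_bound_of_fibres {G H : Type*} [AddCommGroup G] [AddCommGroup H]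
    [IsAddTorsionFree H] [DecidableEq G] [DecidableEq H] (π : G →+ H) (A B : Finset G)
    {a₀ b₀ : ℕ} {m E : ℝ} (hm : 0 < m)
    (ha : ∀ x ∈ A.image π, (fib π A x).card ≤ a₀) (hb : ∀ y ∈ B.image π, (fib π B y).card ≤ b₀)
    (ha' : ∃ x ∈ A.image π, (fib π A x).card = a₀) (hb' : ∃ y ∈ B.image π, (fib π B y).card = b₀)
    (h : ∀ x ∈ A.image π, ∀ y ∈ B.image π,
      m * min ((fib π A x).card / a₀ : ℝ) ((fib π B y).card / b₀ : ℝ) ≤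
        (fib π A x + fib π B y).card + E) :
    m * (A.card / a₀ + B.card / b₀ - 1 : ℝ) ≤
      (A + B).card + E * (A.image π + B.image π).card := by
  obtain ⟨x₀, hx₀, hx₀a⟩ := ha'
  obtain ⟨y₀, hy₀, hy₀b⟩ := hb'
  have ha₀ : (0 : ℝ) < a₀ := by
    rw [← hx₀a]; exact_mod_cast Finset.card_pos.2 (fib_nonempty hx₀)
  have hb₀ : (0 : ℝ) < b₀ := by
    rw [← hy₀b]; exact_mod_cast Finset.card_pos.2 (fib_nonempty hy₀)
  have key := sum_add_sum_sub_le_sum_add _ (A.image π) (B.image π)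
    (fun x => ((fib π A x).card / a₀ : ℝ)) (fun y => ((fib π B y).card / b₀ : ℝ))
    (fun s => ((fib π (A + B) s).card + E) / m) 1 le_rfl
    (fun x hx => ⟨by positivity, by rw [div_le_one ha₀]; exact_mod_cast ha x hx⟩)
    (fun y hy => ⟨by positivity, by rw [div_le_one hb₀]; exact_mod_cast hb y hy⟩)
    ⟨x₀, hx₀, by simp only [hx₀a]; exact div_self ha₀.ne'⟩
    ⟨y₀, hy₀, by simp only [hy₀b]; exact div_self hb₀.ne'⟩
    (fun x hx y hy => by
      rw [le_div_iff₀ hm, mul_comm]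
      refine (h x hx y hy).trans ?_
      gcongr
      exact fib_add_fib_subset π A B x y)
  have hAB : ∀ a ∈ A + B, π a ∈ A.image π + B.image π := by
    intro a haab
    rw [← Finset.image_add π]
    exact Finset.mem_image_of_mem _ haab
  rw [← Finset.sum_div, ← Finset.sum_div, ← Finset.sum_div, Finset.sum_add_distrib,
    sum_card_fib (fun a ha => Finset.mem_image_of_mem π ha),
    sum_card_fib (fun a ha => Finset.mem_image_of_mem π ha), sum_card_fib hAB,
    le_div_iff₀ hm] at key
  simp only [Finset.sum_const, nsmul_eq_mul] at key
  linarith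

/-- The Brunn-Minkowski lower bound in dimension `k` for sets of sizes `a` and `b`. -/
noncomputable def bm (k : ℕ) (a b : ℝ) : ℝ := (a ^ (k : ℝ)⁻¹ + b ^ (k : ℝ)⁻¹) ^ k

theorem bm_mul_le {k : ℕ} {a b a₀ b₀ : ℝ} (ha₀ : 0 < a₀) (hb₀ : 0 < b₀) (ha : 0 ≤ a) (hb : 0 ≤ b)
    (haa : a ≤ a₀) : bm k a₀ b₀ * min (a / a₀) (b / b₀) ≤ bm k a b := by
  set τ := min (a / a₀) (b / b₀) with hτ
  have hτ0 : 0 ≤ τ := le_min (by positivity) (by positivity)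
  have h1 : τ * a₀ ≤ a := by rw [← le_div_iff₀ ha₀]; exact min_le_left _ _
  have h2 : τ * b₀ ≤ b := by rw [← le_div_iff₀ hb₀]; exact min_le_right _ _
  rcases Nat.eq_zero_or_pos k with rfl | hk
  · simp only [bm, pow_zero, one_mul]
    exact (min_le_left _ _).trans ((div_le_one ha₀).2 haa)
  · have hroot : (τ ^ (k : ℝ)⁻¹) ^ k = τ := Real.rpow_inv_natCast_pow hτ0 hk.ne'
    calc bm k a₀ b₀ * τ = (τ ^ (k : ℝ)⁻¹ * (a₀ ^ (k : ℝ)⁻¹ + b₀ ^ (k : ℝ)⁻¹)) ^ k := by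
          rw [mul_pow, hroot, bm, mul_comm]
      _ = ((τ * a₀) ^ (k : ℝ)⁻¹ + (τ * b₀) ^ (k : ℝ)⁻¹) ^ k := by
          rw [Real.mul_rpow hτ0 ha₀.le, Real.mul_rpow hτ0 hb₀.le, mul_add]
      _ ≤ bm k a b := by
          unfold bm
          gcongr

theorem bm_self {k : ℕ} {a : ℝ} (ha : 0 ≤ a) (hk : k = 0 → a = 1) : bm k a a = 2 ^ k * a := by
  rcases Nat.eq_zero_or_pos k with rfl | h
  · simp [bm, hk rfl]
  · rw [bm, ← two_mul, mul_pow, Real.rpow_inv_natCast_pow ha h.ne']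

/-- Hölder's inequality in the form needed to add one dimension. -/
theorem bm_succ_le {p : ℕ} {f g s t : ℝ} (hf : 0 < f) (hg : 0 < g) (hs : 0 < s) (ht : 0 < t) :
    bm (p + 1) (f ^ p * s) (g ^ p * t) ≤ (f + g) ^ p * (s + t) := by
  set k : ℝ := ((p + 1 : ℕ) : ℝ) with hk
  have hk0 : 0 < k := by rw [hk]; positivity
  have hpk : (p : ℝ) / k + k⁻¹ = 1 := by
    rw [hk]; push_cast; field_simp
  have aux : ∀ {x y X Y : ℝ}, 0 < x → 0 < y → 0 < X → 0 < Y →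
      (x ^ p * y) ^ k⁻¹ ≤ (X ^ p * Y) ^ k⁻¹ * ((p / k) * (x / X) + k⁻¹ * (y / Y)) := by
    intro x y X Y hx hy hX hY
    have h := Real.geom_mean_le_arith_mean2_weighted (w₁ := p / k) (w₂ := k⁻¹) (p₁ := x / X)
      (p₂ := y / Y) (by positivity) (by positivity) (by positivity) (by positivity) hpk
    have h2 : (x ^ p * y) ^ k⁻¹ =
        (X ^ p * Y) ^ k⁻¹ * ((x / X) ^ (p / k : ℝ) * (y / Y) ^ k⁻¹) := by
      have : (x / X) ^ (p / k : ℝ) = ((x / X) ^ p) ^ k⁻¹ := by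
        rw [div_eq_mul_inv (p : ℝ), Real.rpow_mul (by positivity), Real.rpow_natCast]
      rw [this, ← Real.mul_rpow (by positivity) (by positivity),
        ← Real.mul_rpow (by positivity) (by positivity)]
      congr 1
      field_simp
      rw [← mul_pow, mul_div_cancel₀ _ hX.ne']
    rw [h2]
    gcongr
  have h1 := aux hf hs (add_pos hf hg) (add_pos hs ht)
  have h2 := aux hg ht (add_pos hf hg) (add_pos hs ht)
  have hsum : (f ^ p * s) ^ k⁻¹ + (g ^ p * t) ^ k⁻¹ ≤ ((f + g) ^ p * (s + t)) ^ k⁻¹ := by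
    refine (add_le_add h1 h2).trans (le_of_eq ?_)
    rw [← mul_add]
    have : (p / k) * (f / (f + g)) + k⁻¹ * (s / (s + t)) +
        ((p / k) * (g / (f + g)) + k⁻¹ * (t / (s + t))) = p / k + k⁻¹ := by
      have := (add_pos hf hg).ne'
      have := (add_pos hs ht).ne'
      field_simp
      ring
    rw [this, hpk, mul_one]
  calc bm (p + 1) (f ^ p * s) (g ^ p * t)
      ≤ (((f + g) ^ p * (s + t)) ^ k⁻¹) ^ (p + 1) := by
        unfold bm
        gcongr
    _ = (f + g) ^ p * (s + t) := Real.rpow_inv_natCast_pow (by positivity) p.succ_ne_zero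

/-- `A` lies in the box with side half-lengths `L` in the coordinates in `I` and is constant in
the other coordinates. -/
def InSlab {M : ℕ} (I : Finset (Fin M)) (L : Fin M → ℕ) (A : Finset (Fin M → ℤ)) : Prop :=
  (∀ i ∈ I, ∀ a ∈ A, |a i| ≤ L i) ∧ ∀ i ∉ I, ∀ a ∈ A, ∀ a' ∈ A, a i = a' i

theorem InSlab.card_le {M : ℕ} {I : Finset (Fin M)} {L : Fin M → ℕ} {A : Finset (Fin M → ℤ)}
    (h : InSlab I L A) : A.card ≤ ∏ i ∈ I, (2 * L i + 1) := by
  rcases A.eq_empty_or_nonempty with rfl | ⟨a₀, ha₀⟩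
  · simp
  have hsub : A ⊆ Fintype.piFinset fun i => if i ∈ I then Finset.Icc (-(L i : ℤ)) (L i)
      else {a₀ i} := by
    intro a ha
    rw [Fintype.mem_piFinset]
    intro i
    by_cases hi : i ∈ I
    · simpa [hi, abs_le] using h.1 i hi a ha
    · simpa [hi] using h.2 i hi a ha a₀ ha₀
  refine (Finset.card_le_card hsub).trans (le_of_eq ?_)
  rw [Fintype.card_piFinset, ← Finset.prod_subset (Finset.subset_univ I)]
  · refine Finset.prod_congr rfl fun i hi => ?_
    rw [if_pos hi, Int.card_Icc]; omega
  · intro i _ hi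
    simp [hi]

theorem bm_le_two_pow_mul {k : ℕ} {a b V : ℝ} (ha : 0 ≤ a) (hb : 0 ≤ b) (haV : a ≤ V) (hbV : b ≤ V)
    (hV : k = 0 → V = 1) : bm k a b ≤ 2 ^ k * V := by
  rw [← bm_self (ha.trans haV) hV]
  unfold bm
  gcongr

/-- An approximate Brunn-Minkowski inequality for subsets of a box all of whose sides are long. -/
theorem approx_brunn_minkowski {M : ℕ} (L : Fin M → ℕ) {D : ℕ} (hD0 : 0 < D) (I : Finset (Fin M)) :
    (∀ i ∈ I, D ≤ L i) → ∀ A B : Finset (Fin M → ℤ), A.Nonempty → B.Nonempty →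
    InSlab I L A → InSlab I L B →
    bm I.card A.card B.card ≤
      (A + B).card + I.card * 2 ^ I.card * ((∏ i ∈ I, (2 * L i + 1) : ℕ) : ℝ) / D := by
  induction I using Finset.induction_on with
  | empty =>
    intro _ A B hA hB _ _
    have : 1 ≤ (A + B).card := Finset.card_pos.2 (hA.add hB)
    simpa [bm] using this
  | insert i I hi ih =>
    intro hD A B hA hB hAs hBs
    have ih' := ih fun j hj => hD j (Finset.mem_insert_of_mem hj)
    set π : (Fin M → ℤ) →+ ℤ := Pi.evalAddMonoidHom (fun _ => ℤ) i with hπ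
    have hslab : ∀ {A : Finset (Fin M → ℤ)}, InSlab (insert i I) L A → ∀ x,
        InSlab I L (fib π A x) := by
      intro A hAs x
      refine ⟨fun j hj a ha => hAs.1 j (Finset.mem_insert_of_mem hj) a (mem_fib.1 ha).1,
        fun j hj a ha a' ha' => ?_⟩
      rw [mem_fib] at ha ha'
      by_cases hji : j = i
      · subst hji
        exact ha.2.trans ha'.2.symm
      · exact hAs.2 j (by simp [hji, hj]) a ha.1 a' ha'.1
    set p := I.card with hp
    set V : ℝ := ((∏ i ∈ I, (2 * L i + 1) : ℕ) : ℝ) with hV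
    have hVp : p = 0 → V = 1 := by
      intro h0
      rw [hp, Finset.card_eq_zero] at h0
      simp [hV, h0]
    have hDpos : (0 : ℝ) < D := by exact_mod_cast hD0
    obtain ⟨x₀, hx₀, hx₀m⟩ := (A.image π).exists_max_image (fun x => (fib π A x).card)
      (hA.image π)
    obtain ⟨y₀, hy₀, hy₀m⟩ := (B.image π).exists_max_image (fun x => (fib π B x).card)
      (hB.image π)
    set a₀ := (fib π A x₀).card with ha₀
    set b₀ := (fib π B y₀).card with hb₀
    have ha₀pos : (0 : ℝ) < a₀ := by exact_mod_cast Finset.card_pos.2 (fib_nonempty hx₀)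
    have hb₀pos : (0 : ℝ) < b₀ := by exact_mod_cast Finset.card_pos.2 (fib_nonempty hy₀)
    have ha₀V : (a₀ : ℝ) ≤ V := by
      rw [hV]; exact Nat.cast_le.2 (hslab hAs x₀).card_le
    have hb₀V : (b₀ : ℝ) ≤ V := by
      rw [hV]; exact Nat.cast_le.2 (hslab hBs y₀).card_le
    have hroot : ∀ {c : ℕ}, (0 : ℝ) < c → (c : ℝ) ≤ V → ((c : ℝ) ^ (p : ℝ)⁻¹) ^ p = c := by
      intro c hc hcV
      rcases Nat.eq_zero_or_pos p with h0 | h0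
      · rw [hVp h0] at hcV
        have h1 : c ≤ 1 := by exact_mod_cast hcV
        have h2 : 0 < c := by exact_mod_cast hc
        have h3 : c = 1 := by omega
        simp [h0, h3]
      · exact Real.rpow_inv_natCast_pow hc.le h0.ne'
    have hmpos : 0 < bm p a₀ b₀ := by unfold bm; positivity
    set E : ℝ := p * 2 ^ p * V / D with hE
    have hE0 : 0 ≤ E := by positivity
    have hfib := sumset_lower_bound_of_fibres π A B (a₀ := a₀) (b₀ := b₀) (m := bm p a₀ b₀) (E := E)
      hmpos hx₀m hy₀m ⟨x₀, hx₀, rfl⟩ ⟨y₀, hy₀, rfl⟩ (fun x hx y hy => by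
        refine (bm_mul_le ha₀pos hb₀pos (by positivity) (by positivity)
          (by exact_mod_cast hx₀m x hx)).trans ?_
        exact ih' _ _ (fib_nonempty hx) (fib_nonempty hy) (hslab hAs x) (hslab hBs y))
    have hApos : (0 : ℝ) < A.card := by exact_mod_cast Finset.card_pos.2 hA
    have hBpos : (0 : ℝ) < B.card := by exact_mod_cast Finset.card_pos.2 hB
    have hholder : bm (p + 1) A.card B.card ≤ bm p a₀ b₀ * (A.card / a₀ + B.card / b₀) := by
      have h := bm_succ_le (p := p) (f := (a₀ : ℝ) ^ (p : ℝ)⁻¹) (g := (b₀ : ℝ) ^ (p : ℝ)⁻¹)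
        (s := A.card / a₀) (t := B.card / b₀) (by positivity) (by positivity) (by positivity)
        (by positivity)
      rw [hroot ha₀pos ha₀V, hroot hb₀pos hb₀V, mul_div_cancel₀ _ ha₀pos.ne',
        mul_div_cancel₀ _ hb₀pos.ne'] at h
      exact h
    have hcount : ((A.image π + B.image π).card : ℝ) ≤ 2 * (2 * L i + 1) := by
      have hsub : A.image π + B.image π ⊆ Finset.Icc (-(2 * L i : ℤ)) (2 * L i) := by
        intro z hz
        obtain ⟨x, hx, y, hy, rfl⟩ := Finset.mem_add.1 hz
        obtain ⟨a, ha, rfl⟩ := Finset.mem_image.1 hx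
        obtain ⟨b, hb, rfl⟩ := Finset.mem_image.1 hy
        have h1 := abs_le.1 (hAs.1 i (Finset.mem_insert_self i I) a ha)
        have h2 := abs_le.1 (hBs.1 i (Finset.mem_insert_self i I) b hb)
        change a i + b i ∈ _
        rw [Finset.mem_Icc]
        constructor <;> linarith [h1.1, h1.2, h2.1, h2.2]
      have h := Finset.card_le_card hsub
      rw [Int.card_Icc] at h
      have h' : (A.image π + B.image π).card ≤ 2 * (2 * L i + 1) := by omega
      exact_mod_cast h'
    have hbmV := bm_le_two_pow_mul ha₀pos.le hb₀pos.le ha₀V hb₀V hVp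
    have hDL : (D : ℝ) ≤ L i := by exact_mod_cast hD i (Finset.mem_insert_self i I)
    rw [Finset.card_insert_of_notMem hi, Finset.prod_insert hi]
    refine hholder.trans ?_
    have hprod : (((2 * L i + 1) * ∏ i ∈ I, (2 * L i + 1) : ℕ) : ℝ) = (2 * L i + 1) * V := by
      push_cast [hV]; rfl
    rw [hprod]
    have h1 : E * (A.image π + B.image π).card ≤ E * (2 * (2 * L i + 1)) := by gcongr
    have hV0 : 0 ≤ V := ha₀pos.le.trans ha₀V
    have h2 : 2 ^ p * V ≤ 2 ^ p * V * (2 * L i + 1) / D := by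
      rw [le_div_iff₀ hDpos]
      have : 0 ≤ 2 ^ p * V := by positivity
      nlinarith
    have h3 : ((p + 1 : ℕ) : ℝ) * 2 ^ (p + 1) * ((2 * L i + 1) * V) / D =
        E * (2 * (2 * L i + 1)) + 2 * (2 ^ p * V * (2 * L i + 1) / D) := by
      rw [hE, pow_succ]; push_cast; ring
    have h4 : 0 ≤ 2 ^ p * V * (2 * L i + 1) / D := by positivity
    rw [h3]
    linarith

/-- Multiples of `N` among the nonzero residues modulo `p`, pulled back by a dilation. -/
theorem card_filter_dvd_val_mul_le {p : ℕ} [Fact p.Prime] (N : ℕ) {d : ZMod p} (hd : d ≠ 0) :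
    (Finset.univ.filter fun q : ZMod p => q ≠ 0 ∧ N ∣ (q * d).val).card ≤ (p - 1) / N := by
  rw [← Nat.Ioc_filter_dvd_card_eq_div]
  refine Finset.card_le_card_of_injOn (fun q => (q * d).val) ?_ ?_
  · intro q hq
    simp only [Finset.coe_filter, Finset.mem_univ, true_and, mem_ofPred_eq] at hq
    have h1 := ZMod.val_lt (q * d)
    have h2 : (q * d).val ≠ 0 := by
      rw [Ne, ZMod.val_eq_zero]; exact mul_ne_zero hq.1 hd
    simp only [Finset.coe_filter, Finset.mem_Ioc, mem_ofPred_eq]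
    exact ⟨⟨by omega, by omega⟩, hq.2⟩
  · intro q _ q' _ h
    exact mul_right_cancel₀ hd (ZMod.val_injective p h)

/-- A dilation avoiding multiples of `N` on a set of fewer than `N` nonzero residues. -/
theorem exists_dilation_not_dvd {p : ℕ} [Fact p.Prime] {N : ℕ} (S : Finset (ZMod p))
    (hS : S.card < N) (h0 : (0 : ZMod p) ∉ S) :
    ∃ q : ZMod p, ∀ d ∈ S, ¬ N ∣ (q * d).val := by
  by_contra! hcon
  have hp2 := (Fact.out : p.Prime).two_le
  have hsub : (Finset.univ.erase (0 : ZMod p)) ⊆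
      S.biUnion fun d => Finset.univ.filter fun q : ZMod p => q ≠ 0 ∧ N ∣ (q * d).val := by
    intro q hq
    obtain ⟨d, hd, hdv⟩ := hcon q
    simp only [Finset.mem_biUnion, Finset.mem_filter, Finset.mem_univ, true_and]
    exact ⟨d, hd, Finset.ne_of_mem_erase hq, hdv⟩
  have h1 := (Finset.card_le_card hsub).trans Finset.card_biUnion_le
  have h2 := h1.trans (Finset.sum_le_card_nsmul S _ ((p - 1) / N) fun d hd =>
    card_filter_dvd_val_mul_le N (fun h => h0 (h ▸ hd)))
  rw [Finset.card_erase_of_mem (Finset.mem_univ _), Finset.card_univ, ZMod.card, smul_eq_mul] at h2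
  have h3 : N * ((p - 1) / N) ≤ p - 1 := Nat.mul_div_le _ _
  rcases Nat.eq_zero_or_pos ((p - 1) / N) with h | h
  · rw [h] at h2; omega
  · have h4 : S.card * ((p - 1) / N) < N * ((p - 1) / N) := Nat.mul_lt_mul_of_pos_right hS h
    omega

theorem sum_mem_nsmul {G : Type*} [AddCommMonoid G] [DecidableEq G] {A : Finset G} {s : ℕ}
    {a : Fin s → G} (ha : ∀ i, a i ∈ A) : ∑ i, a i ∈ s • A := by
  rw [Finset.mem_nsmul]
  exact ⟨fun i => ⟨a i, ha i⟩, by rw [List.sum_ofFn]⟩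

/-- Ruzsa's modelling lemma: a large part of `A` is Freiman isomorphic of order `s` to a subset of
a cyclic group of order `#(sA - sA)`. -/
theorem exists_freiman_model (A : Finset ℤ) (hA : A.Nonempty) {s : ℕ} (hs : 0 < s) :
    ∃ A' ⊆ A, A.card ≤ s * A'.card ∧ ∃ ψ : ℤ → ZMod (s • A - s • A).card,
      ∀ a b : Fin s → ℤ, (∀ i, a i ∈ A') → (∀ i, b i ∈ A') →
        (∑ i, ψ (a i) = ∑ i, ψ (b i) ↔ ∑ i, a i = ∑ i, b i) := by
  classical
  set W := s • A - s • A with hW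
  set N := W.card with hN
  have hWne : (0 : ℤ) ∈ W := by
    obtain ⟨x, hx⟩ := hA
    have h : ∑ _i : Fin s, x ∈ s • A := sum_mem_nsmul fun _ => hx
    rw [hW, Finset.mem_sub]
    exact ⟨_, h, _, h, sub_self _⟩
  obtain ⟨p, hpB, hp⟩ := Nat.exists_infinite_primes (W.sup Int.natAbs + 1)
  have : Fact p.Prime := ⟨hp⟩
  have hp0 : 0 < p := hp.pos
  have hcast : ∀ d ∈ W, d ≠ 0 → (d : ZMod p) ≠ 0 := by
    intro d hd hd0 h
    rw [ZMod.intCast_zmod_eq_zero_iff_dvd] at h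
    have h1 : d.natAbs ≤ W.sup Int.natAbs := Finset.le_sup (f := Int.natAbs) hd
    have h2 := Nat.le_of_dvd (Int.natAbs_pos.2 hd0) (Int.natCast_dvd.1 h)
    omega
  obtain ⟨q, hq⟩ := exists_dilation_not_dvd (N := N) ((W.erase 0).image fun d : ℤ => (d : ZMod p))
    (by
      refine Finset.card_image_le.trans_lt ?_
      exact Finset.card_erase_lt_of_mem hWne)
    (by
      intro h
      obtain ⟨d, hd, h0⟩ := Finset.mem_image.1 h
      exact hcast d (Finset.mem_of_mem_erase hd) (Finset.ne_of_mem_erase hd) h0)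
  set f : ℤ → ℕ := fun a => (q * (a : ZMod p)).val with hf
  have hflt : ∀ a, f a < p := fun a => ZMod.val_lt _
  have hmaps : ∀ a ∈ A, s * f a / p ∈ Finset.range s := by
    intro a _
    rw [Finset.mem_range, Nat.div_lt_iff_lt_mul hp0]
    exact Nat.mul_lt_mul_of_pos_left (hflt a) hs
  obtain ⟨j, -, hj⟩ := (Finset.range s).exists_max_image
    (fun j => (A.filter fun a => s * f a / p = j).card) (Finset.nonempty_range_iff.2 hs.ne')
  have hcard := Finset.card_le_mul_card_image_of_maps_to hmaps _ hj
  rw [Finset.card_range, mul_comm] at hcard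
  refine ⟨A.filter fun a => s * f a / p = j, Finset.filter_subset _ _, hcard,
    fun a => (f a : ZMod N), ?_⟩
  have hsum : ∀ a : Fin s → ℤ, ((∑ i, f (a i) : ℕ) : ZMod p) = q * ((∑ i, a i : ℤ) : ZMod p) := by
    intro a
    simp only [hf]
    push_cast
    rw [Finset.mul_sum]
    exact Finset.sum_congr rfl fun i _ => ZMod.natCast_zmod_val _
  have hbd : ∀ a b : Fin s → ℤ, (∀ i, a i ∈ A.filter fun a => s * f a / p = j) →
      (∀ i, b i ∈ A.filter fun a => s * f a / p = j) →
      ∑ i, f (a i) < ∑ i, f (b i) + p := by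
    intro a b ha hb
    have h1 : ∀ i, s * f (a i) < s * f (b i) + p := by
      intro i
      have e1 := (Finset.mem_filter.1 (ha i)).2
      have e2 := (Finset.mem_filter.1 (hb i)).2
      have e3 := Nat.lt_mul_div_succ (s * f (a i)) hp0
      have e4 := Nat.mul_div_le (s * f (b i)) p
      rw [e1] at e3
      rw [e2] at e4
      rw [mul_add, mul_one] at e3
      omega
    have h2 : ∑ i, s * f (a i) < ∑ i, (s * f (b i) + p) :=
      Finset.sum_lt_sum_of_nonempty ⟨⟨0, hs⟩, Finset.mem_univ _⟩ fun i _ => h1 i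
    rw [Finset.sum_add_distrib, ← Finset.mul_sum, ← Finset.mul_sum, Finset.sum_const,
      Finset.card_univ, Fintype.card_fin, smul_eq_mul, ← mul_add] at h2
    exact Nat.lt_of_mul_lt_mul_left h2
  have hback : ∀ a b : Fin s → ℤ, (∀ i, a i ∈ A.filter fun a => s * f a / p = j) →
      (∀ i, b i ∈ A.filter fun a => s * f a / p = j) → ∑ i, f (b i) ≤ ∑ i, f (a i) →
      ((∑ i, f (a i) : ℕ) : ZMod N) = ((∑ i, f (b i) : ℕ) : ZMod N) → ∑ i, a i = ∑ i, b i := by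
    intro a b ha hb hle h
    by_contra hne
    have hdW : ∑ i, a i - ∑ i, b i ∈ W := by
      rw [hW, Finset.mem_sub]
      exact ⟨_, sum_mem_nsmul fun i => (Finset.mem_filter.1 (ha i)).1, _,
        sum_mem_nsmul fun i => (Finset.mem_filter.1 (hb i)).1, rfl⟩
    have h1 := hq _ (Finset.mem_image_of_mem _
      (Finset.mem_erase.2 ⟨sub_ne_zero.2 hne, hdW⟩))
    apply h1
    have h2 : (q * ((∑ i, a i - ∑ i, b i : ℤ) : ZMod p)).val =
        ∑ i, f (a i) - ∑ i, f (b i) := by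
      rw [Int.cast_sub, mul_sub, ← hsum, ← hsum, ← Nat.cast_sub hle, ZMod.val_natCast,
        Nat.mod_eq_of_lt]
      have := hbd a b ha hb
      omega
    rw [h2]
    exact (Nat.modEq_iff_dvd' hle).1 ((ZMod.natCast_eq_natCast_iff _ _ _).1 h.symm)
  intro a b ha hb
  simp only [← Nat.cast_sum]
  constructor
  · intro h
    rcases le_total (∑ i, f (b i)) (∑ i, f (a i)) with hle | hle
    · exact hback a b ha hb hle h
    · exact (hback b a hb ha hle h.symm).symm
  · intro h
    have h1 : ((∑ i, f (a i) : ℕ) : ZMod p) = ((∑ i, f (b i) : ℕ) : ZMod p) := by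
      rw [hsum, hsum, h]
    rw [ZMod.natCast_eq_natCast_iff] at h1
    have h2 := hbd a b ha hb
    have h3 := hbd b a hb ha
    rw [h1.eq_of_abs_lt (by rw [abs_lt]; constructor <;> omega)]

section Bogolyubov

variable {G : Type*} [AddCommGroup G] [Fintype G]

theorem charSum_normSq (B : Finset G) (χ : AddChar G ℂ) :
    ((‖∑ b ∈ B, χ b‖ ^ 2 : ℝ) : ℂ) = ∑ u ∈ B ×ˢ B, χ (u.1 - u.2) := by
  rw [Complex.ofReal_pow, ← Complex.mul_conj', map_sum, Finset.sum_mul_sum, Finset.sum_product]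
  refine Finset.sum_congr rfl fun a _ => Finset.sum_congr rfl fun b _ => ?_
  rw [sub_eq_add_neg, AddChar.map_add_eq_mul, AddChar.map_neg_eq_conj]

variable [DecidableEq G]

theorem sum_charSum_normSq (B : Finset G) :
    ∑ χ : AddChar G ℂ, ‖∑ b ∈ B, χ b‖ ^ 2 = Fintype.card G * B.card := by
  have h : ((∑ χ : AddChar G ℂ, ‖∑ b ∈ B, χ b‖ ^ 2 : ℝ) : ℂ) = Fintype.card G * B.card := by
    rw [Complex.ofReal_sum]
    simp_rw [charSum_normSq]
    rw [Finset.sum_comm]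
    simp_rw [AddChar.sum_apply_eq_ite, sub_eq_zero, Finset.sum_product]
    simp [mul_comm]
  exact_mod_cast h

theorem exists_sum_sub_of_charSum_ne_zero (B : Finset G) (x : G)
    (h : ∑ χ : AddChar G ℂ, ((‖∑ b ∈ B, χ b‖ ^ 2 : ℝ) : ℂ) * ((‖∑ b ∈ B, χ b‖ ^ 2 : ℝ) : ℂ) * χ x
      ≠ 0) :
    ∃ a ∈ B, ∃ b ∈ B, ∃ c ∈ B, ∃ d ∈ B, x = a + b - c - d := by
  contrapose! h
  simp_rw [charSum_normSq, Finset.sum_mul_sum, Finset.sum_mul, ← AddChar.map_add_eq_mul]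
  rw [Finset.sum_comm]
  refine Finset.sum_eq_zero fun u hu => ?_
  rw [Finset.sum_comm]
  refine Finset.sum_eq_zero fun v hv => ?_
  rw [AddChar.sum_apply_eq_ite, if_neg]
  intro h0
  rw [Finset.mem_product] at hu hv
  refine h u.2 hu.2 v.2 hv.2 u.1 hu.1 v.1 hv.1 ?_
  rw [← sub_eq_zero, ← h0]
  abel

/-- Bogolyubov's lemma in terms of characters. -/
theorem exists_characters_bogolyubov (B : Finset G) (hB : B.Nonempty) :
    ∃ Γ : Finset (AddChar G ℂ), Γ.card * B.card ^ 2 ≤ 2 * Fintype.card G ^ 2 ∧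
      ∀ x, (∀ χ ∈ Γ, 0 ≤ (χ x).re) →
        ∃ a ∈ B, ∃ b ∈ B, ∃ c ∈ B, ∃ d ∈ B, x = a + b - c - d := by
  classical
  set S : AddChar G ℂ → ℝ := fun χ => ‖∑ b ∈ B, χ b‖ ^ 2 with hS
  set n : ℝ := (B.card : ℝ) with hn
  set N : ℝ := (Fintype.card G : ℝ) with hN
  have hn0 : 0 < n := by rw [hn]; exact_mod_cast hB.card_pos
  have hnN : n ≤ N := by rw [hn, hN]; exact_mod_cast Finset.card_le_univ B
  have hN0 : 0 < N := hn0.trans_le hnN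
  have hS0 : ∀ χ, 0 ≤ S χ := fun χ => by positivity
  have hsum : ∑ χ, S χ = N * n := sum_charSum_normSq B
  set θ : ℝ := n ^ 3 / (2 * N) with hθ
  have hθ0 : 0 < θ := by positivity
  refine ⟨Finset.univ.filter fun χ => θ ≤ S χ, ?_, ?_⟩
  · have h1 : ((Finset.univ.filter fun χ => θ ≤ S χ).card : ℝ) * θ ≤ N * n := by
      rw [← hsum, ← nsmul_eq_mul]
      refine (Finset.card_nsmul_le_sum _ S θ fun χ hχ => (Finset.mem_filter.1 hχ).2).trans ?_
      exact Finset.sum_le_sum_of_subset_of_nonneg (Finset.filter_subset _ _) fun χ _ _ => hS0 χ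
    have h2 : ((Finset.univ.filter fun χ => θ ≤ S χ).card : ℝ) * n ^ 2 ≤ 2 * N ^ 2 := by
      rw [hθ, mul_div_assoc', div_le_iff₀ (by positivity)] at h1
      nlinarith
    rw [hn, hN] at h2
    exact_mod_cast h2
  · intro x hx
    apply exists_sum_sub_of_charSum_ne_zero
    intro h0
    have h1 : ∑ χ : AddChar G ℂ, S χ * S χ * (χ x).re = 0 := by
      have := congrArg Complex.re h0
      rw [Complex.re_sum] at this
      simp only [← Complex.ofReal_mul, Complex.re_ofReal_mul, Complex.zero_re] at this
      exact this
    have hre : ∀ χ : AddChar G ℂ, -1 ≤ (χ x).re := by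
      intro χ
      have := (abs_le.1 (Complex.abs_re_le_norm (χ x))).1
      rwa [AddChar.norm_apply] at this
    have hz : S 0 = n ^ 2 := by simp [hS, hn]
    have hle : ∀ χ : AddChar G ℂ,
        (if χ = 0 then n ^ 4 else 0) - θ * S χ ≤ S χ * S χ * (χ x).re := by
      intro χ
      have hp := mul_nonneg hθ0.le (hS0 χ)
      split_ifs with h
      · subst h
        simp only [AddChar.zero_apply, Complex.one_re, mul_one]
        rw [hz] at hp ⊢
        nlinarith
      · by_cases hχ : θ ≤ S χ
        · have := mul_nonneg (mul_nonneg (hS0 χ) (hS0 χ))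
            (hx χ (Finset.mem_filter.2 ⟨Finset.mem_univ _, hχ⟩))
          linarith
        · push Not at hχ
          have h2 := mul_le_mul_of_nonneg_left (hre χ) (mul_nonneg (hS0 χ) (hS0 χ))
          have h3 := mul_le_mul_of_nonneg_right hχ.le (hS0 χ)
          linarith
    have h2 := Finset.sum_le_sum fun χ (_ : χ ∈ Finset.univ) => hle χ
    rw [h1, Finset.sum_sub_distrib, Finset.sum_ite_eq' Finset.univ (0 : AddChar G ℂ),
      if_pos (Finset.mem_univ _), ← Finset.mul_sum, hsum, hθ] at h2
    have h3 : n ^ 3 / (2 * N) * (N * n) = n ^ 4 / 2 := by field_simp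
    rw [h3] at h2
    have : 0 < n ^ 4 := by positivity
    linarith

end Bogolyubov

/-- The vectors of logarithms of the values of the characters `c` at a common point. -/
def logLattice {G : Type*} [AddCommGroup G] {r : ℕ} (c : Fin r → AddChar G ℂ) :
    AddSubgroup (Fin r → ℝ) where
  carrier := {v | ∃ x : G, ∀ i, Complex.exp (2 * Real.pi * v i * Complex.I) = c i x}
  zero_mem' := ⟨0, fun i => by simp⟩
  add_mem' := by
    rintro v w ⟨x, hx⟩ ⟨y, hy⟩
    refine ⟨x + y, fun i => ?_⟩
    rw [AddChar.map_add_eq_mul, ← hx, ← hy, ← Complex.exp_add]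
    congr 1
    simp only [Pi.add_apply]
    push_cast
    ring
  neg_mem' := by
    rintro v ⟨x, hx⟩
    refine ⟨-x, fun i => ?_⟩
    rw [AddChar.map_neg_eq_inv, ← hx, ← Complex.exp_neg]
    congr 1
    simp only [Pi.neg_apply]
    push_cast
    ring

theorem mem_logLattice {G : Type*} [AddCommGroup G] {r : ℕ} {c : Fin r → AddChar G ℂ}
    {v : Fin r → ℝ} :
    v ∈ logLattice c ↔ ∃ x : G, ∀ i, Complex.exp (2 * Real.pi * v i * Complex.I) = c i x :=
  Iff.rfl

theorem exists_int_of_exp_eq_one {θ : ℝ} (h : Complex.exp (2 * Real.pi * θ * Complex.I) = 1) :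
    ∃ m : ℤ, θ = m := by
  obtain ⟨m, hm⟩ := Complex.exp_eq_one_iff.1 h
  refine ⟨m, ?_⟩
  have h2 : (2 * Real.pi * Complex.I : ℂ) ≠ 0 := by simp [Real.pi_ne_zero]
  have h3 : (θ : ℂ) = m := by
    apply mul_right_cancel₀ h2
    rw [← hm]; ring
  exact_mod_cast h3

theorem logLattice_finite_ball {N : ℕ} [NeZero N] {r : ℕ} (c : Fin r → AddChar (ZMod N) ℂ)
    (R : ℝ) : {v | v ∈ logLattice c ∧ ‖v‖ ≤ R}.Finite := by
  have hN : (0 : ℝ) < N := by exact_mod_cast Nat.pos_of_ne_zero (NeZero.ne N)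
  refine ((Set.finite_Icc (fun _ : Fin r => -⌈N * R⌉) (fun _ => ⌈N * R⌉)).image
    fun m i => (m i : ℝ) / N).subset ?_
  rintro v ⟨⟨x, hx⟩, hv⟩
  have h1 : ∀ i, ∃ m : ℤ, N * v i = m := by
    intro i
    apply exists_int_of_exp_eq_one
    have : (2 * Real.pi * ((N * v i : ℝ) : ℂ) * Complex.I : ℂ) =
        N * (2 * Real.pi * v i * Complex.I) := by push_cast; ring
    rw [this, Complex.exp_nat_mul, hx, ← AddChar.map_nsmul_eq_pow]
    simp
  choose m hm using h1
  have hmb : ∀ i, |m i| ≤ ⌈N * R⌉ := by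
    intro i
    have h2 : (|m i| : ℝ) ≤ N * R := by
      rw [← hm, abs_mul, abs_of_pos hN]
      exact mul_le_mul_of_nonneg_left ((norm_le_pi_norm v i).trans hv) hN.le
    have := h2.trans (Int.le_ceil _)
    exact_mod_cast this
  refine ⟨m, ⟨fun i => (abs_le.1 (hmb i)).1, fun i => (abs_le.1 (hmb i)).2⟩, ?_⟩
  funext i
  simp only [← hm]
  field_simp

theorem exp_arg_div_two_pi {z : ℂ} (hz : ‖z‖ = 1) :
    Complex.exp (2 * Real.pi * ((z.arg / (2 * Real.pi) : ℝ) : ℂ) * Complex.I) = z := by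
  have h := Complex.norm_mul_exp_arg_mul_I z
  rw [hz, Complex.ofReal_one, one_mul] at h
  rw [← h]
  congr 2
  have : (Real.pi : ℂ) ≠ 0 := by exact_mod_cast Real.pi_ne_zero
  rw [h]
  push_cast
  field_simp

/-- Bohr sets of bounded rank in cyclic groups contain large proper progressions. -/
theorem exists_box_in_bohr (r : ℕ) : ∃ Q : ℕ, ∀ (N : ℕ) [NeZero N]
    (c : Fin r → AddChar (ZMod N) ℂ), (∃ i, c i = ZMod.stdAddChar) →
    ∃ (g : Fin r → ZMod N) (L : Fin r → ℕ),
      (∀ n ∈ intBox L, ∀ i, 0 ≤ (c i (∑ j, n j • g j)).re) ∧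
      (∀ n ∈ intBox L, ∀ n' ∈ intBox L, ∑ j, n j • g j = ∑ j, n' j • g j → n = n') ∧
      N ≤ Q * ∏ i, (2 * L i + 1) := by
  classical
  obtain ⟨C, hC1, hC⟩ := exists_lattice_box r
  have hC0 : 0 < C := by linarith
  set R : ℝ := 1 / (4 * C) with hR
  have hR0 : 0 < R := by positivity
  have hCR : C * R = 1 / 4 := by rw [hR]; field_simp
  obtain ⟨q, hq⟩ := exists_nat_gt (1 / R)
  have hq0 : (0 : ℝ) < q := lt_trans (by positivity) hq
  refine ⟨(2 * q + 1) ^ r, ?_⟩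
  intro N _ c ⟨i₀, hi₀⟩
  obtain ⟨b, L, hb, hcov, hnorm, hinj⟩ := hC (Fin r → ℝ) (by simp) (logLattice c)
    (logLattice_finite_ball c) R hR0
  choose g hg using fun i => mem_logLattice.1 (hb i)
  have hgn : ∀ n : Fin r → ℤ, ∀ i, Complex.exp (2 * Real.pi * ((∑ j, n j • b j) i : ℝ) * Complex.I)
      = c i (∑ j, n j • g j) := by
    intro n i
    have hprod : c i (∑ j, n j • g j) = ∏ j, c i (n j • g j) := by
      simpa [← ofAdd_sum] using
        map_prod (c i).toMonoidHom (fun j => Multiplicative.ofAdd (n j • g j)) Finset.univ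
    rw [hprod]
    simp_rw [AddChar.map_zsmul_eq_zpow, ← hg, ← Complex.exp_int_mul]
    rw [← Complex.exp_sum]
    congr 1
    have hv : (∑ j, n j • b j) i = ∑ j, (n j : ℝ) * b j i := by
      rw [Finset.sum_apply]
      exact Finset.sum_congr rfl fun j _ => by rw [Pi.smul_apply, zsmul_eq_mul]
    rw [hv]
    push_cast
    rw [Finset.mul_sum, Finset.sum_mul]
    exact Finset.sum_congr rfl fun j _ => by ring
  have hsmall : ∀ n ∈ intBox L, ∀ i, |(∑ j, n j • b j) i| ≤ 1 / 4 := by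
    intro n hn i
    have := hnorm n (mem_intBox.1 hn)
    rw [hCR] at this
    exact (norm_le_pi_norm _ i).trans this
  refine ⟨g, L, ?_, ?_, ?_⟩
  · intro n hn i
    rw [← hgn]
    have h1 := hsmall n hn i
    have h2 : (2 * Real.pi * ((∑ j, n j • b j) i : ℝ) * Complex.I : ℂ) =
      ((2 * Real.pi * (∑ j, n j • b j) i : ℝ) : ℂ) * Complex.I := by push_cast; ring
    rw [h2, Complex.exp_ofReal_mul_I_re]
    rw [abs_le] at h1
    apply Real.cos_nonneg_of_neg_pi_div_two_le_of_le <;> nlinarith [Real.pi_pos]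
  · intro n hn n' hn' h
    apply hinj n n' (mem_intBox.1 hn) (mem_intBox.1 hn')
    funext i
    have h1 : Complex.exp (2 * Real.pi *
        (((∑ j, n j • b j) i - (∑ j, n' j • b j) i : ℝ) : ℂ) * Complex.I) = 1 := by
      have e : (2 * Real.pi *
        (((∑ j, n j • b j) i - (∑ j, n' j • b j) i : ℝ) : ℂ) * Complex.I) =
        2 * Real.pi * ((∑ j, n j • b j) i : ℝ) * Complex.I -
        2 * Real.pi * ((∑ j, n' j • b j) i : ℝ) * Complex.I := by push_cast; ring
      rw [e, Complex.exp_sub, hgn, hgn, h, div_self]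
      rw [← hgn]
      exact Complex.exp_ne_zero _
    obtain ⟨m, hm⟩ := exists_int_of_exp_eq_one h1
    have h2 : |(m : ℝ)| < 1 := by
      rw [← hm]
      have := abs_sub ((∑ j, n j • b j) i) ((∑ j, n' j • b j) i)
      linarith [hsmall n hn i, hsmall n' hn' i]
    have h3 : m = 0 := by
      have : |m| < 1 := by exact_mod_cast h2
      exact Int.abs_lt_one_iff.1 this
    rw [h3, Int.cast_zero] at hm
    linarith
  · set lam : ZMod N → Fin r → ℝ := fun x i => (c i x).arg / (2 * Real.pi) with hlam
    have hlame : ∀ x i, Complex.exp (2 * Real.pi * (lam x i : ℂ) * Complex.I) = c i x :=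
      fun x i => exp_arg_div_two_pi (AddChar.norm_apply _ _)
    have hlamb : ∀ x i, |lam x i| ≤ 1 := by
      intro x i
      rw [hlam, abs_div, abs_of_pos (by positivity : 0 < 2 * Real.pi),
        div_le_one (by positivity)]
      linarith [Complex.abs_arg_le_pi (c i x), Real.pi_pos]
    set cell : ZMod N → Fin r → ℤ := fun x i => ⌊q * lam x i⌋ with hcell
    have hmaps : ∀ x ∈ (Finset.univ : Finset (ZMod N)), cell x ∈ intBox fun _ : Fin r => q := by
      intro x _
      rw [mem_intBox]
      intro i
      have h1 := abs_le.1 (hlamb x i)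
      rw [abs_le]
      constructor
      · rw [hcell, Int.le_floor]; push_cast; nlinarith
      · have : (⌊(q : ℝ) * lam x i⌋ : ℝ) ≤ q := (Int.floor_le _).trans (by nlinarith)
        exact_mod_cast this
    obtain ⟨y, -, hy⟩ := (intBox fun _ : Fin r => q).exists_max_image
      (fun y => (Finset.univ.filter fun x => cell x = y).card)
      ⟨cell 0, hmaps 0 (Finset.mem_univ _)⟩
    have hcard := Finset.card_le_mul_card_image_of_maps_to hmaps _ hy
    rw [Finset.card_univ, ZMod.card, card_intBox, Finset.prod_const, Finset.card_univ,
      Fintype.card_fin, mul_comm] at hcard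
    refine hcard.trans (Nat.mul_le_mul_left _ ?_)
    rcases (Finset.univ.filter fun x => cell x = y).eq_empty_or_nonempty with h0 | ⟨x₀, hx₀⟩
    · rw [h0]; simp
    · rw [← card_intBox]
      refine (Finset.card_le_card (t := (intBox L).image fun n => x₀ + ∑ j, n j • g j) ?_).trans
        Finset.card_image_le
      intro x hx
      rw [Finset.mem_filter] at hx hx₀
      have hmem : lam x - lam x₀ ∈ logLattice c :=
        sub_mem (mem_logLattice.2 ⟨x, hlame x⟩) (mem_logLattice.2 ⟨x₀, hlame x₀⟩)
      have hle : ‖lam x - lam x₀‖ ≤ R := by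
        rw [pi_norm_le_iff_of_nonneg hR0.le]
        intro i
        have h1 : ⌊q * lam x i⌋ = ⌊q * lam x₀ i⌋ := congrFun (hx.2.trans hx₀.2.symm) i
        have h2 := Int.abs_sub_lt_one_of_floor_eq_floor h1
        rw [← mul_sub, abs_mul, abs_of_pos hq0] at h2
        rw [Pi.sub_apply, Real.norm_eq_abs]
        rw [div_lt_iff₀ hR0] at hq
        have h3 : q * |lam x i - lam x₀ i| < q * R := h2.trans hq
        exact (lt_of_mul_lt_mul_left h3 hq0.le).le
      obtain ⟨n, hn, hxn⟩ := hcov _ hmem hle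
      refine Finset.mem_image.2 ⟨n, mem_intBox.2 hn, ?_⟩
      have h4 : c i₀ (∑ j, n j • g j) = c i₀ (x - x₀) := by
        rw [← hgn, ← hxn, sub_eq_add_neg x, AddChar.map_add_eq_mul, AddChar.map_neg_eq_inv,
          ← hlame, ← hlame, ← Complex.exp_neg, ← Complex.exp_add]
        congr 1
        simp only [Pi.sub_apply]
        push_cast
        ring
      rw [hi₀] at h4
      rw [ZMod.injective_stdAddChar h4]
      abel

theorem card_nsmul_sub_nsmul_le {A : Finset ℤ} (hA : A.Nonempty) {K : ℕ}
    (hK : (A + A).card ≤ K * A.card) (m n : ℕ) :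
    (m • A - n • A).card ≤ K ^ (m + n) * A.card := by
  have h := Finset.pluennecke_ruzsa_inequality_nsmul_sub_nsmul_add hA A m n
  have hpos : (0 : ℚ≥0) < A.card := by exact_mod_cast hA.card_pos
  have h2 : ((A + A).card / A.card : ℚ≥0) ≤ K := by
    rw [div_le_iff₀ hpos]; exact_mod_cast hK
  have h3 : ((m • A - n • A).card : ℚ≥0) ≤ K ^ (m + n) * A.card := by
    refine h.trans ?_
    gcongr
  exact_mod_cast h3

theorem exists_padded_enumeration {α : Type*} (S : Finset α) (hS : S.Nonempty) {r : ℕ}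
    (h : S.card ≤ r) : ∃ c : Fin r → α, ∀ x ∈ S, ∃ i, c i = x := by
  classical
  obtain ⟨f⟩ : Nonempty (S ↪ Fin r) := Function.Embedding.nonempty_of_card_le (by simpa using h)
  have : Nonempty S := hS.to_subtype
  exact ⟨fun i => (Function.invFun f i : S), fun x hx =>
    ⟨f ⟨x, hx⟩, congrArg Subtype.val (Function.leftInverse_invFun f.injective ⟨x, hx⟩)⟩⟩

/-- A function which is additive on a box is linear there. -/
theorem eq_sum_of_additive_on_intBox {r : ℕ} {L : Fin r → ℕ} {f : (Fin r → ℤ) → ℤ}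
    (hf : ∀ n ∈ intBox L, ∀ m ∈ intBox L, n + m ∈ intBox L → f (n + m) = f n + f m) :
    ∀ n ∈ intBox L, f n = ∑ j, n j * f (Pi.single j 1) := by
  have key : ∀ k : ℕ, ∀ n ∈ intBox L, ∑ j, (n j).natAbs = k →
      f n = ∑ j, n j * f (Pi.single j 1) := by
    intro k
    induction k with
    | zero =>
      intro n hn h
      have hn0 : n = 0 := by
        funext j
        exact Int.natAbs_eq_zero.1 (Finset.sum_eq_zero_iff.1 h j (Finset.mem_univ _))
      subst hn0
      have := hf 0 hn 0 hn (by simpa using hn)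
      simp only [add_zero] at this
      simp only [Pi.zero_apply, zero_mul, Finset.sum_const_zero]
      omega
    | succ k ih =>
      intro n hn h
      obtain ⟨j, hj⟩ : ∃ j, n j ≠ 0 := by
        by_contra! h0
        simp [h0] at h
      have hn' := mem_intBox.1 hn
      have hLj : 1 ≤ L j := by
        have h1 := hn' j
        have h2 := Int.one_le_abs hj
        omega
      have he : (Pi.single j 1 : Fin r → ℤ) ∈ intBox L := by
        rw [mem_intBox]
        intro i
        by_cases hi : i = j
        · subst hi; simpa using hLj
        · simp [hi]
      have step : ∀ ε : ℤ, |n j + ε| + 1 = |n j| →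
          n + ε • Pi.single j 1 ∈ intBox L ∧
          f (n + ε • Pi.single j 1) = ∑ i, n i * f (Pi.single i 1) + ε * f (Pi.single j 1) := by
        intro ε hε
        have hmem : n + ε • Pi.single j 1 ∈ intBox L := by
          rw [mem_intBox]
          intro i
          by_cases hi : i = j
          · subst hi
            have := hn' i
            simp only [Pi.add_apply, Pi.smul_apply, Pi.single_eq_same, smul_eq_mul, mul_one]
            omega
          · simpa [hi] using hn' i
        refine ⟨hmem, ?_⟩
        rw [ih _ hmem]
        · simp only [Pi.add_apply, Pi.smul_apply, smul_eq_mul, add_mul, Finset.sum_add_distrib]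
          congr 1
          rw [Finset.sum_eq_single j]
          · simp
          · intro i _ hi; simp [hi]
          · simp
        · rw [Finset.sum_eq_add_sum_sdiff_singleton_of_mem (Finset.mem_univ j)] at h ⊢
          have e : ∑ x ∈ Finset.univ \ {j}, ((n + ε • Pi.single j 1 : Fin r → ℤ) x).natAbs =
              ∑ x ∈ Finset.univ \ {j}, (n x).natAbs := by
            refine Finset.sum_congr rfl fun i hi => ?_
            have hij : i ≠ j := by simpa using hi
            simp [hij]
          rw [e]
          simp only [Pi.add_apply, Pi.smul_apply, Pi.single_eq_same, smul_eq_mul, mul_one]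
          rw [Int.abs_eq_natAbs, Int.abs_eq_natAbs] at hε
          omega
      rcases lt_or_gt_of_ne hj with hneg | hpos
      · obtain ⟨h1, h2⟩ := step 1 (by rw [abs_of_neg hneg, abs_of_nonpos (by omega)]; omega)
        have h3 := hf n hn _ he (by simpa using h1)
        rw [one_smul] at h2
        rw [h2] at h3
        linarith
      · obtain ⟨h1, h2⟩ := step (-1) (by rw [abs_of_pos hpos, abs_of_nonneg (by omega)]; omega)
        have h3 := hf _ h1 _ he (by simpa using hn)
        rw [h2, neg_smul, one_smul, neg_add_cancel_right] at h3
        linarith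
  exact fun n hn => key _ n hn rfl

/-- The graph of the map induced by `ψ` on fourfold sums and differences of elements of `A`. -/
def DiffRep {H : Type*} [AddCommGroup H] (A : Finset ℤ) (ψ : ℤ → H) (x : H) (y : ℤ) : Prop :=
  ∃ a ∈ A, ∃ b ∈ A, ∃ c ∈ A, ∃ d ∈ A, x = ψ a + ψ b - ψ c - ψ d ∧ y = a + b - c - d

theorem DiffRep.add_iff {H : Type*} [AddCommGroup H] {A : Finset ℤ} {ψ : ℤ → H}
    (hψ : ∀ a b : Fin 6 → ℤ, (∀ i, a i ∈ A) → (∀ i, b i ∈ A) →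
      (∑ i, ψ (a i) = ∑ i, ψ (b i) ↔ ∑ i, a i = ∑ i, b i))
    {x₁ x₂ x₃ : H} {y₁ y₂ y₃ : ℤ} (h₁ : DiffRep A ψ x₁ y₁) (h₂ : DiffRep A ψ x₂ y₂)
    (h₃ : DiffRep A ψ x₃ y₃) : x₃ = x₁ + x₂ ↔ y₃ = y₁ + y₂ := by
  obtain ⟨a₁, ha₁, b₁, hb₁, c₁, hc₁, d₁, hd₁, rfl, rfl⟩ := h₁
  obtain ⟨a₂, ha₂, b₂, hb₂, c₂, hc₂, d₂, hd₂, rfl, rfl⟩ := h₂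
  obtain ⟨a₃, ha₃, b₃, hb₃, c₃, hc₃, d₃, hd₃, rfl, rfl⟩ := h₃
  have h := hψ ![a₃, b₃, c₁, d₁, c₂, d₂] ![a₁, b₁, a₂, b₂, c₃, d₃]
    (by intro i; fin_cases i <;> assumption) (by intro i; fin_cases i <;> assumption)
  simp only [Fin.sum_univ_succ, Matrix.cons_val_zero, Matrix.cons_val_succ,
    Finset.univ_eq_empty, Finset.sum_empty] at h
  rw [← sub_eq_zero, ← sub_eq_zero (a := a₃ + b₃ - c₃ - d₃)]
  rw [← sub_eq_zero, ← sub_eq_zero (a := a₃ + _)] at h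
  convert h using 2
  · abel
  · ring

theorem DiffRep.mem {H : Type*} [AddCommGroup H] {A : Finset ℤ} {ψ : ℤ → H} {x : H} {y : ℤ}
    (h : DiffRep A ψ x y) : y ∈ 2 • A - 2 • A := by
  obtain ⟨a, ha, b, hb, c, hc, d, hd, -, rfl⟩ := h
  rw [two_nsmul, sub_sub]
  exact Finset.sub_mem_sub (Finset.add_mem_add ha hb) (Finset.add_mem_add hc hd)

/-- A set of small doubling has a large proper progression inside `2A - 2A`. -/
theorem exists_box_in_two_sub_two (K : ℕ) : ∃ r Q : ℕ, ∀ A : Finset ℤ, A.Nonempty →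
    (A + A).card ≤ K * A.card → ∃ (h : Fin r → ℤ) (L : Fin r → ℕ),
      (∀ n ∈ intBox L, ∑ j, n j * h j ∈ 2 • A - 2 • A) ∧
      (∀ n ∈ intBox L, ∀ m ∈ intBox L, ∑ j, n j * h j = ∑ j, m j * h j → n = m) ∧
      A.card ≤ Q * ∏ i, (2 * L i + 1) := by
  classical
  set r := 72 * K ^ 24 + 1 with hr
  obtain ⟨Q, hQ⟩ := exists_box_in_bohr r
  refine ⟨r, 6 * Q, fun A hA hK => ?_⟩
  have hmodel := exists_freiman_model A hA (s := 6) (by norm_num)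
  have hNK := card_nsmul_sub_nsmul_le hA hK 6 6
  have hNpos : 0 < (6 • A - 6 • A).card := Finset.card_pos.2 (hA.nsmul.sub hA.nsmul)
  generalize (6 • A - 6 • A).card = N at hmodel hNK hNpos
  obtain ⟨A', hA'A, hA'card, ψ, hψ⟩ := hmodel
  have hA'ne : A'.Nonempty := by
    rw [← Finset.card_pos]
    have := hA.card_pos
    omega
  have : NeZero N := ⟨hNpos.ne'⟩
  have hψinj : Set.InjOn ψ A' := by
    intro x hx y hy hxy
    have := (hψ (fun _ => x) (fun _ => y) (fun _ => hx) (fun _ => hy)).1 (by simp [hxy])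
    simpa using this
  set B := A'.image ψ with hB
  have hBcard : B.card = A'.card := Finset.card_image_of_injOn hψinj
  obtain ⟨Γ, hΓcard, hΓ⟩ := exists_characters_bogolyubov B (hA'ne.image ψ)
  rw [ZMod.card] at hΓcard
  have hΓr : Γ.card ≤ 72 * K ^ 24 := by
    have hNB : N ≤ 6 * K ^ 12 * B.card := by
      rw [hBcard]
      calc N ≤ K ^ 12 * A.card := hNK
        _ ≤ K ^ 12 * (6 * A'.card) := Nat.mul_le_mul_left _ hA'card
        _ = _ := by ring
    have h1 : Γ.card * B.card ^ 2 ≤ 72 * K ^ 24 * B.card ^ 2 := by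
      calc _ ≤ 2 * N ^ 2 := hΓcard
        _ ≤ 2 * (6 * K ^ 12 * B.card) ^ 2 := by gcongr
        _ = _ := by ring
    exact Nat.le_of_mul_le_mul_right h1 (pow_pos (hA'ne.image ψ).card_pos 2)
  obtain ⟨c, hc⟩ := exists_padded_enumeration (insert ZMod.stdAddChar Γ)
    (Finset.insert_nonempty _ _) (r := r)
    ((Finset.card_insert_le _ _).trans (Nat.add_le_add_right hΓr 1))
  obtain ⟨g, L, hgre, hginj, hgcard⟩ := hQ N c (hc _ (Finset.mem_insert_self _ _))
  have hrep : ∀ n ∈ intBox L, ∃ y, DiffRep A' ψ (∑ j, n j • g j) y := by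
    intro n hn
    obtain ⟨a', ha', b', hb', e', he', d', hd', hx⟩ := hΓ (∑ j, n j • g j) (fun χ hχ => by
      obtain ⟨i, rfl⟩ := hc χ (Finset.mem_insert_of_mem hχ)
      exact hgre n hn i)
    obtain ⟨a, ha, rfl⟩ := Finset.mem_image.1 ha'
    obtain ⟨b, hb, rfl⟩ := Finset.mem_image.1 hb'
    obtain ⟨e, he, rfl⟩ := Finset.mem_image.1 he'
    obtain ⟨d, hd, rfl⟩ := Finset.mem_image.1 hd'
    exact ⟨_, a, ha, b, hb, e, he, d, hd, hx, rfl⟩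
  have hrep' : ∀ n : Fin r → ℤ, ∃ y, n ∈ intBox L → DiffRep A' ψ (∑ j, n j • g j) y := by
    intro n
    by_cases hn : n ∈ intBox L
    · obtain ⟨y, hy⟩ := hrep n hn
      exact ⟨y, fun _ => hy⟩
    · exact ⟨0, fun h => absurd h hn⟩
  choose f hf using hrep'
  have hadd : ∀ n ∈ intBox L, ∀ m ∈ intBox L, n + m ∈ intBox L → f (n + m) = f n + f m := by
    intro n hn m hm hnm
    refine (DiffRep.add_iff hψ (hf n hn) (hf m hm) (hf _ hnm)).1 ?_
    simp only [Pi.add_apply, add_smul, Finset.sum_add_distrib]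
  have hlin := eq_sum_of_additive_on_intBox hadd
  refine ⟨fun j => f (Pi.single j 1), L, ?_, ?_, ?_⟩
  · intro n hn
    rw [← hlin n hn]
    have h2 : 2 • A' ⊆ 2 • A := Finset.nsmul_subset_nsmul_left hA'A
    exact Finset.sub_subset_sub h2 h2 (hf n hn).mem
  · intro n hn m hm h
    rw [← hlin n hn, ← hlin m hm] at h
    apply hginj n hn m hm
    obtain ⟨a, ha⟩ := hA'ne
    have hz : DiffRep A' ψ 0 0 := ⟨a, ha, a, ha, a, ha, a, ha, by abel, by ring⟩
    have := (DiffRep.add_iff hψ (hf m hm) hz (hf n hn)).2 (by rw [h, add_zero])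
    rw [this, add_zero]
  · calc A.card ≤ 6 * A'.card := hA'card
      _ = 6 * B.card := by rw [hBcard]
      _ ≤ 6 * N := by
        refine Nat.mul_le_mul_left _ ((Finset.card_le_univ B).trans ?_)
        rw [ZMod.card]
      _ ≤ 6 * (Q * ∏ i, (2 * L i + 1)) := Nat.mul_le_mul_left _ hgcard
      _ = _ := by ring

/-- Freiman's theorem for sets of integers. -/
theorem freiman (K : ℕ) : ∃ M C : ℕ, ∀ A : Finset ℤ, A.Nonempty →
    (A + A).card ≤ K * A.card → ∃ (a : Fin M → ℤ) (L : Fin M → ℕ),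
      (∀ x ∈ A, ∃ n ∈ intBox L, x = ∑ i, n i * a i) ∧
      ∏ i, (2 * L i + 1) ≤ C * A.card := by
  classical
  obtain ⟨r, Q, hQ⟩ := exists_box_in_two_sub_two K
  set s := K ^ 5 * Q with hs
  refine ⟨s + r, 3 ^ s * 2 ^ r * K ^ 4, fun A hA hK => ?_⟩
  obtain ⟨h, L, hsub, hinj, hcard⟩ := hQ A hA hK
  set P := (intBox L).image fun n => ∑ j, n j * h j with hP
  have hPsub : P ⊆ 2 • A - 2 • A := by
    intro x hx
    obtain ⟨n, hn, rfl⟩ := Finset.mem_image.1 hx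
    exact hsub n hn
  have hPcard : P.card = ∏ i, (2 * L i + 1) := by
    rw [hP, Finset.card_image_of_injOn fun n hn m hm e => hinj n hn m hm e, card_intBox]
  have hPne : P.Nonempty := by
    have h0 : (0 : Fin r → ℤ) ∈ intBox L := mem_intBox.2 fun i => by simp
    exact ⟨_, Finset.mem_image_of_mem _ h0⟩
  have hAP : (A + P).card ≤ s * P.card := by
    calc (A + P).card ≤ (3 • A - 2 • A).card := by
          refine Finset.card_le_card ((Finset.add_subset_add_left hPsub).trans ?_)
          rw [← add_sub_assoc, ← succ_nsmul']
      _ ≤ K ^ 5 * A.card := card_nsmul_sub_nsmul_le hA hK 3 2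
      _ ≤ K ^ 5 * (Q * P.card) := by rw [hPcard]; exact Nat.mul_le_mul_left _ hcard
      _ = _ := by rw [hs]; ring
  obtain ⟨F, hFA, hFcard, hFcov⟩ := Finset.ruzsa_covering_add (A := A) (B := P) (K := (s : ℝ)) hPne
    (by exact_mod_cast hAP)
  have hFne : F.Nonempty := by
    obtain ⟨x, hx⟩ := hA
    obtain ⟨y, hy, -⟩ := Finset.mem_add.1 (hFcov hx)
    exact ⟨y, hy⟩
  obtain ⟨e, he⟩ := exists_padded_enumeration F hFne (r := s) (by exact_mod_cast hFcard)
  refine ⟨Fin.append e h, Fin.append (fun _ => 1) (fun i => 2 * L i), ?_, ?_⟩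
  · intro x hx
    obtain ⟨y, hy, z, hz, rfl⟩ := Finset.mem_add.1 (hFcov hx)
    obtain ⟨u, hu, v, hv, rfl⟩ := Finset.mem_sub.1 hz
    obtain ⟨n, hn, rfl⟩ := Finset.mem_image.1 hu
    obtain ⟨m, hm, rfl⟩ := Finset.mem_image.1 hv
    obtain ⟨i, rfl⟩ := he y hy
    refine ⟨Fin.append (Pi.single i 1) (n - m), ?_, ?_⟩
    · rw [mem_intBox] at hn hm ⊢
      intro j
      refine Fin.addCases (fun j => ?_) (fun j => ?_) j
      · rw [Fin.append_left, Fin.append_left]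
        by_cases hj : j = i
        · subst hj; simp
        · simp [hj]
      · rw [Fin.append_right, Fin.append_right, Pi.sub_apply]
        have h1 := abs_le.1 (hn j)
        have h2 := abs_le.1 (hm j)
        rw [abs_le]
        push_cast
        constructor <;> linarith
    · rw [Fin.sum_univ_add]
      simp only [Fin.append_left, Fin.append_right, Pi.sub_apply, sub_mul,
        Finset.sum_sub_distrib]
      congr 1
      rw [Finset.sum_eq_single i]
      · simp
      · intro j _ hj; simp [hj]
      · simp
  · rw [Fin.prod_univ_add]
    simp only [Fin.append_left, Fin.append_right]
    rw [Finset.prod_const, Finset.card_univ, Fintype.card_fin]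
    have h1 : ∏ i, (2 * (2 * L i) + 1) ≤ 2 ^ r * P.card := by
      rw [hPcard]
      calc ∏ i, (2 * (2 * L i) + 1) ≤ ∏ i, (2 * (2 * L i + 1)) :=
            Finset.prod_le_prod' fun i _ => by omega
        _ = _ := by simp [Finset.prod_mul_distrib]
    have h2 : P.card ≤ K ^ 4 * A.card :=
      (Finset.card_le_card hPsub).trans (card_nsmul_sub_nsmul_le hA hK 2 2)
    calc (2 * 1 + 1) ^ s * ∏ i, (2 * (2 * L i) + 1) ≤ 3 ^ s * (2 ^ r * (K ^ 4 * A.card)) := by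
          gcongr
          exact h1.trans (Nat.mul_le_mul_left _ h2)
      _ = _ := by ring

/-- Freiman's theorem with a `4`-proper progression. -/
theorem freiman_proper (K : ℕ) : ∃ M C : ℕ, ∀ A : Finset ℤ, A.Nonempty →
    (A + A).card ≤ K * A.card → ∃ (a : Fin M → ℤ) (L : Fin M → ℕ),
      (∀ x ∈ A, ∃ n ∈ intBox L, x = ∑ i, n i * a i) ∧
      ∏ i, (2 * L i + 1) ≤ C * A.card ∧
      ∀ v : Fin M → ℤ, (∀ i, |v i| ≤ 4 * L i) → ∑ i, v i * a i = 0 → v = 0 := by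
  obtain ⟨M, C, hMC⟩ := freiman K
  obtain ⟨C', hC'⟩ := exists_proper_cover M 4 C
  refine ⟨M, C', fun A hA hK => ?_⟩
  obtain ⟨a, L, hcov, hcard⟩ := hMC A hA hK
  exact_mod_cast hC' A a L hcov hcard

/-- Finitely many side lengths leave a gap at some bounded scale. -/
theorem exists_scale_gap (H : ℕ → ℕ) (M : ℕ) :
    ∃ T, ∀ L : Fin M → ℕ, ∃ N ≤ T, ∀ i, L i ≤ N ∨ H N ≤ L i := by
  set s : ℕ → ℕ := fun j => Nat.rec 0 (fun _ x => x + H x) j with hs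
  have hsucc : ∀ j, s (j + 1) = s j + H (s j) := fun j => rfl
  have hmono : Monotone s := monotone_nat_of_le_succ fun j => by rw [hsucc]; omega
  refine ⟨s M, fun L => ?_⟩
  by_contra! hcon
  choose i hi using fun j : Fin (M + 1) => hcon (s j) (hmono (Nat.lt_succ_iff.1 j.2))
  have hlt : ∀ j j' : Fin (M + 1), j < j' → i j ≠ i j' := by
    intro j j' hjj h
    have h1 := (hi j).2
    have h2 := (hi j').1
    have h3 := hmono (Nat.succ_le_of_lt (Fin.lt_def.1 hjj))
    rw [Nat.succ_eq_add_one, hsucc] at h3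
    rw [h] at h1
    omega
  have hinj : Function.Injective i := by
    intro j j' h
    rcases lt_trichotomy j j' with hj | hj | hj
    · exact absurd h (hlt _ _ hj)
    · exact hj
    · exact absurd h.symm (hlt _ _ hj)
  have := Fintype.card_le_of_injective i hinj
  simp at this

/-- The homomorphism forgetting the coordinates in `I`. -/
def dropCoords {M : ℕ} (I : Finset (Fin M)) : (Fin M → ℤ) →+ (Fin M → ℤ) where
  toFun n i := if i ∈ I then 0 else n i
  map_zero' := by ext; simp
  map_add' m n := by ext i; by_cases h : i ∈ I <;> simp [h]

theorem dropCoords_apply {M : ℕ} (I : Finset (Fin M)) (n : Fin M → ℤ) (i : Fin M) :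
    dropCoords I n i = if i ∈ I then 0 else n i := rfl

theorem inSlab_fib {M : ℕ} {I : Finset (Fin M)} {L : Fin M → ℕ} {A : Finset (Fin M → ℤ)}
    (hA : A ⊆ intBox L) (x : Fin M → ℤ) : InSlab I L (fib (dropCoords I) A x) := by
  refine ⟨fun i _ a ha => mem_intBox.1 (hA (mem_fib.1 ha).1) i, fun i hi a ha a' ha' => ?_⟩
  have h := congrFun ((mem_fib.1 ha).2.trans (mem_fib.1 ha').2.symm) i
  rwa [dropCoords_apply, dropCoords_apply, if_neg hi, if_neg hi] at h

/-- Lower bounds for the sumset in terms of the fibres over the short coordinates. -/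
theorem exists_max_fibre {M : ℕ} {I : Finset (Fin M)} {L : Fin M → ℕ} {A : Finset (Fin M → ℤ)}
    (hA : A ⊆ intBox L) (hne : A.Nonempty) {D : ℕ} (hD0 : 0 < D) (hD : ∀ i ∈ I, D ≤ L i) {E : ℝ}
    (hE : I.card * 2 ^ I.card * ((∏ i ∈ I, (2 * L i + 1) : ℕ) : ℝ) / D ≤ E) :
    ∃ x₀ ∈ A.image (dropCoords I),
      (∀ x ∈ A.image (dropCoords I),
        (fib (dropCoords I) A x).card ≤ (fib (dropCoords I) A x₀).card) ∧
      bm I.card (fib (dropCoords I) A x₀).card (fib (dropCoords I) A x₀).card =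
        2 ^ I.card * (fib (dropCoords I) A x₀).card ∧
      (2 : ℝ) ^ I.card * (2 * A.card - (fib (dropCoords I) A x₀).card) ≤
        (A + A).card + E * (A.image (dropCoords I)).card ^ 2 ∧
      ∑ x ∈ A.image (dropCoords I),
        bm I.card (fib (dropCoords I) A x₀).card (fib (dropCoords I) A x).card ≤
        (A + A).card + E * (A.image (dropCoords I)).card := by
  classical
  set π := dropCoords I with hπ
  obtain ⟨x₀, hx₀, hmax⟩ := (A.image π).exists_max_image (fun x => (fib π A x).card) (hne.image π)
  set a₀ := (fib π A x₀).card with ha₀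
  have hE0 : 0 ≤ E := le_trans (by positivity) hE
  have ha₀pos : 0 < a₀ := Finset.card_pos.2 (fib_nonempty hx₀)
  have ha₀pos' : (0 : ℝ) < a₀ := by exact_mod_cast ha₀pos
  have hself : bm I.card a₀ a₀ = 2 ^ I.card * a₀ := by
    refine bm_self ha₀pos'.le fun h0 => ?_
    have h1 := (inSlab_fib (I := I) hA x₀).card_le
    rw [Finset.card_eq_zero] at h0
    rw [h0, Finset.prod_empty] at h1
    have h2 : a₀ = 1 := le_antisymm (by rw [ha₀, hπ, h0]; exact h1) ha₀pos
    exact_mod_cast h2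
  have hbm : ∀ x ∈ A.image π, ∀ y ∈ A.image π,
      bm I.card (fib π A x).card (fib π A y).card ≤ (fib π A x + fib π A y).card + E := by
    intro x hx y hy
    refine (approx_brunn_minkowski L hD0 I hD _ _ (fib_nonempty hx) (fib_nonempty hy)
      (inSlab_fib hA x) (inSlab_fib hA y)).trans ?_
    linarith
  refine ⟨x₀, hx₀, hmax, hself, ?_, ?_⟩
  · have h := sumset_lower_bound_of_fibres π A A (a₀ := a₀) (b₀ := a₀) (m := bm I.card a₀ a₀)
      (E := E) (by rw [hself]; positivity) hmax hmax ⟨x₀, hx₀, rfl⟩ ⟨x₀, hx₀, rfl⟩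
      (fun x hx y hy => (bm_mul_le ha₀pos' ha₀pos' (by positivity) (by positivity)
        (by exact_mod_cast hmax x hx)).trans (hbm x hx y hy))
    rw [hself] at h
    have h1 : (2 : ℝ) ^ I.card * a₀ * (A.card / a₀ + A.card / a₀ - 1) =
        2 ^ I.card * (2 * A.card - a₀) := by field_simp; ring
    rw [h1] at h
    refine h.trans (add_le_add_right ?_ _)
    refine mul_le_mul_of_nonneg_left ?_ hE0
    have := Finset.card_add_le (s := A.image π) (t := A.image π)
    rw [sq]
    exact_mod_cast this
  · have h1 : ∑ x ∈ A.image π, ((fib π A x₀ + fib π A x).card : ℝ) ≤ (A + A).card := by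
      have hdisj : ((A.image π : Finset _) : Set (Fin M → ℤ)).PairwiseDisjoint
          fun x => fib π A x₀ + fib π A x := by
        intro x _ y _ hxy
        refine Finset.disjoint_left.2 fun z hz hz' => hxy ?_
        have e1 := (mem_fib.1 (fib_add_fib_subset π A A x₀ x hz)).2
        have e2 := (mem_fib.1 (fib_add_fib_subset π A A x₀ y hz')).2
        exact add_left_cancel (e1.symm.trans e2)
      have h2 := Finset.card_biUnion hdisj
      have h3 : ((A.image π).biUnion fun x => fib π A x₀ + fib π A x) ⊆ A + A := by
        rw [Finset.biUnion_subset]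
        exact fun x _ => Finset.add_subset_add (Finset.filter_subset _ _) (Finset.filter_subset _ _)
      have h4 := Finset.card_le_card h3
      rw [h2] at h4
      exact_mod_cast h4
    refine (Finset.sum_le_sum fun x hx => hbm x₀ hx₀ x hx).trans ?_
    rw [Finset.sum_add_distrib, Finset.sum_const, nsmul_eq_mul, mul_comm E]
    linarith

theorem one_sub_pow_le_pow_sub_pow {u w ρ : ℝ} (hρ0 : 0 ≤ ρ) (hρ1 : ρ ≤ 1) (hu : 1 ≤ u)
    (hw : ρ ≤ w) (huw : u - w = 1 - ρ) (d : ℕ) : 1 - ρ ^ d ≤ u ^ d - w ^ d := by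
  induction d with
  | zero => simp
  | succ d ih =>
    have h1 : ρ ^ d ≤ w ^ d := pow_le_pow_left₀ hρ0 hw d
    have h2 : ρ ^ d ≤ 1 := pow_le_one₀ hρ0 hρ1
    have e : u ^ (d + 1) - w ^ (d + 1) = u * (u ^ d - w ^ d) + w ^ d * (u - w) := by ring
    rw [e, huw, pow_succ]
    nlinarith [mul_le_mul_of_nonneg_right h1 (sub_nonneg.2 hρ1),
      mul_nonneg (sub_nonneg.2 hu) (ih.trans' (sub_nonneg.2 h2))]

theorem le_bm_of_le_half {d : ℕ} (hd : d ≠ 0) {a b c : ℝ} (ha : 0 < a) (hb : 0 ≤ b)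
    (hab : b ≤ a / 2) (hc : c / 2 ≤ 0.7 * 2 ^ d - 1) : a + c * b ≤ bm d a b := by
  set β₀ : ℝ := (1 / 2 : ℝ) ^ (d : ℝ)⁻¹ with hβ₀
  set ρ : ℝ := (2 * b / a) ^ (d : ℝ)⁻¹ with hρ
  have hβ₀p : 0 < β₀ := by positivity
  have hβ₀d : β₀ ^ d = 1 / 2 := Real.rpow_inv_natCast_pow (by norm_num) hd
  have hρd : ρ ^ d = 2 * b / a := Real.rpow_inv_natCast_pow (by positivity) hd
  have hρ0 : 0 ≤ ρ := by positivity
  have hρ1 : ρ ≤ 1 := Real.rpow_le_one (by positivity) (by rw [div_le_one ha]; linarith)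
    (by positivity)
  have hroot : b ^ (d : ℝ)⁻¹ = a ^ (d : ℝ)⁻¹ * (ρ * β₀) := by
    rw [hρ, hβ₀, ← Real.mul_rpow (by positivity) (by norm_num),
      ← Real.mul_rpow ha.le (by positivity)]
    congr 1
    field_simp
  have hbm : bm d a b = a * (1 + ρ * β₀) ^ d := by
    have h1 : a ^ (d : ℝ)⁻¹ + b ^ (d : ℝ)⁻¹ = a ^ (d : ℝ)⁻¹ * (1 + ρ * β₀) := by
      rw [hroot]; ring
    rw [bm, h1, mul_pow, Real.rpow_inv_natCast_pow ha.le hd]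
  have h1 := one_sub_pow_le_pow_sub_pow (u := 1 + ρ * β₀) (w := ρ * (1 + β₀)) hρ0 hρ1
    (by nlinarith) (by nlinarith) (by ring) d
  rw [mul_pow, hρd] at h1
  have h2 : 0.7 * 2 ^ d ≤ (1 + β₀) ^ d := by
    have h3 : (4 * β₀) ^ d ≤ ((1 + β₀) ^ 2) ^ d :=
      pow_le_pow_left₀ (by positivity) (by nlinarith [sq_nonneg (1 - β₀)]) d
    rw [mul_pow, hβ₀d, ← pow_mul, mul_comm 2 d, pow_mul] at h3
    have h4 : (4 : ℝ) ^ d = (2 ^ d) ^ 2 := by rw [← pow_mul, mul_comm, pow_mul]; norm_num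
    rw [h4] at h3
    refine le_of_sq_le_sq ?_ (by positivity)
    nlinarith [sq_nonneg ((2 : ℝ) ^ d)]
  rw [hbm]
  have h5 : 1 + 2 * b / a * (c / 2) ≤ (1 + ρ * β₀) ^ d := by
    have h6 : 0 ≤ 2 * b / a := by positivity
    nlinarith
  calc a + c * b = a * (1 + 2 * b / a * (c / 2)) := by field_simp
    _ ≤ _ := mul_le_mul_of_nonneg_left h5 ha.le

theorem le_bm_left {d : ℕ} {a b : ℝ} (ha : 0 ≤ a) (hb : 0 ≤ b) (hd : d = 0 → a = 1) :
    a ≤ bm d a b := by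
  rcases Nat.eq_zero_or_pos d with rfl | h
  · simp [bm, hd rfl]
  · calc a = (a ^ (d : ℝ)⁻¹) ^ d := (Real.rpow_inv_natCast_pow ha h.ne').symm
      _ ≤ _ := by
        unfold bm
        have : 0 ≤ b ^ (d : ℝ)⁻¹ := by positivity
        gcongr
        linarith

/-- Sharp bound on the number of fibres. -/
theorem card_fibres_le {ι : Type*} {d l : ℕ}
    (hl : (l : ℝ) ≤ 0.1 * 2 ^ d ∨ ((l : ℝ) ≤ 0.315 * 2 ^ d ∧ 13 ≤ d)) {X : Finset ι} {x₀ : ι}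
    (hx₀ : x₀ ∈ X) {f : ι → ℝ} (hf : ∀ x ∈ X, 0 ≤ f x) (hf₀ : 0 < f x₀)
    (hself : bm d (f x₀) (f x₀) = 2 ^ d * f x₀) {W E : ℝ} (hE0 : 0 ≤ E)
    (h₁ : 2 ^ d * (2 * ∑ x ∈ X, f x - f x₀) ≤ W + E * X.card ^ 2)
    (h₂ : ∑ x ∈ X, bm d (f x₀) (f x) ≤ W + E * X.card)
    (hW : W ≤ (2 ^ d + l) * ∑ x ∈ X, f x) (hE : E * X.card ^ 2 ≤ (∑ x ∈ X, f x) / 100) :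
    X.card ≤ l + 1 := by
  classical
  set S := ∑ x ∈ X, f x with hS
  set a := f x₀ with ha
  set n : ℝ := (X.card : ℝ) with hn
  have hn1 : 1 ≤ n := by rw [hn]; exact_mod_cast Finset.card_pos.2 ⟨x₀, hx₀⟩
  have hEn : E * n ≤ S / 100 := by
    have : E * n ≤ E * n ^ 2 := mul_le_mul_of_nonneg_left (by nlinarith) hE0
    linarith
  have hp : (1 : ℝ) ≤ 2 ^ d := one_le_pow₀ (by norm_num)
  have hl' : (l : ℝ) ≤ 0.315 * 2 ^ d := by
      rcases hl with h | h
      · linarith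
      · exact h.1
  have hsplit : S = a + ∑ x ∈ X.erase x₀, f x := (Finset.add_sum_erase X f hx₀).symm
  have haS : a ≤ S := by
    rw [hsplit]
    have := Finset.sum_nonneg fun x (hx : x ∈ X.erase x₀) => hf x (Finset.mem_of_mem_erase hx)
    linarith
  have hS0 : 0 < S := hf₀.trans_le haS
  have hbound : (2 ^ d - l - 0.01) * S ≤ 2 ^ d * a := by nlinarith
  have hbmsplit := Finset.add_sum_erase X (fun x => bm d a (f x)) hx₀
  simp only [← ha] at hbmsplit
  rw [← hbmsplit, hself] at h₂
  by_contra! hcon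
  have hcard : ((X.erase x₀).card : ℝ) = n - 1 := by
    rw [Finset.card_erase_of_mem hx₀, Nat.cast_sub (Finset.card_pos.2 ⟨x₀, hx₀⟩), Nat.cast_one]
  have hnl : (l : ℝ) + 2 ≤ n := by rw [hn]; exact_mod_cast hcon
  rcases Nat.eq_zero_or_pos l with hl0 | hl0
  · have h3 : (n - 1) * a ≤ ∑ x ∈ X.erase x₀, bm d a (f x) := by
      rw [← hcard, ← nsmul_eq_mul]
      refine Finset.card_nsmul_le_sum _ _ _ fun x hx =>
        le_bm_left hf₀.le (hf x (Finset.mem_of_mem_erase hx)) fun h0 => ?_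
      subst h0
      simpa [bm] using hself.symm
    rw [hl0, Nat.cast_zero] at hW hbound hnl
    have h4 : a ≤ (n - 1) * a := by nlinarith
    have h5 : 0.99 * S ≤ a := by nlinarith
    nlinarith
  · have hl1 : (1 : ℝ) ≤ l := by exact_mod_cast hl0
    have hd0 : d ≠ 0 := by
      rintro rfl
      rw [pow_zero] at hl'
      linarith
    have hc : (2 ^ d + (l : ℝ)) / 2 ≤ 0.7 * 2 ^ d - 1 := by
      rcases hl with h | ⟨h, hd⟩
      · linarith
      · have : (2 : ℝ) ^ 13 ≤ 2 ^ d := pow_le_pow_right₀ (by norm_num) hd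
        norm_num at this
        linarith
    have h2 : (3 : ℝ) ≤ 2 ^ d := by nlinarith
    have ha' : 0.67 * S ≤ a := by nlinarith
    have h3 : ∑ x ∈ X.erase x₀, (a + (2 ^ d + (l : ℝ)) * f x) ≤
        ∑ x ∈ X.erase x₀, bm d a (f x) := by
      refine Finset.sum_le_sum fun x hx => ?_
      refine le_bm_of_le_half hd0 hf₀ (hf x (Finset.mem_of_mem_erase hx)) ?_ hc
      have h4 : f x ≤ ∑ y ∈ X.erase x₀, f y :=
        Finset.single_le_sum (fun y hy => hf y (Finset.mem_of_mem_erase hy)) hx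
      linarith
    rw [Finset.sum_add_distrib, Finset.sum_const, nsmul_eq_mul, hcard, ← Finset.mul_sum] at h3
    have h4 : ∑ x ∈ X.erase x₀, f x = S - a := by linarith
    rw [h4] at h3
    have h5 : (n - 1 - l) * a ≤ E * n := by nlinarith
    nlinarith

/-- A box spanned by at most `e` generators is a translate of a subset of an `e`-GAP of the expected
size. -/
theorem exists_isGAP_cover {M e : ℕ} {I : Finset (Fin M)} (hI : I.card ≤ e) (a : Fin M → ℤ)
    (L : Fin M → ℕ) : ∃ (P : Set ℤ) (c : ℤ), IsGAP e P ∧ P.Finite ∧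
      P.ncard ≤ ∏ i ∈ I, (2 * L i + 1) ∧
      ∀ n : Fin M → ℤ, (∀ i ∈ I, |n i| ≤ L i) → ∃ p ∈ P, ∑ i ∈ I, n i * a i = c + p := by
  classical
  obtain ⟨f⟩ : Nonempty (I ↪ Fin e) := Function.Embedding.nonempty_of_card_le (by simpa using hI)
  set a' : Fin e → ℤ := Function.extend f (fun i => a i) 0 with ha'
  set l' : Fin e → ℕ := Function.extend f (fun i => 2 * L i + 1) 1 with hl'
  have hext : ∀ i, a' (f i) = a i := fun i => f.injective.extend_apply _ _ _
  have hextl : ∀ i, l' (f i) = 2 * L i + 1 := fun i => f.injective.extend_apply _ _ _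
  have hnot : ∀ j ∉ Set.range f, a' j = 0 := fun j hj => Function.extend_apply' _ _ _ hj
  have hnotl : ∀ j ∉ Set.range f, l' j = 1 := fun j hj => Function.extend_apply' _ _ _ hj
  set P : Set ℤ := {x | ∃ lam : Fin e → ℕ, (∀ i, 1 ≤ lam i ∧ lam i ≤ l' i) ∧
    x = ∑ i, (lam i : ℤ) * a' i} with hP
  have hPsub : P ⊆ ((Fintype.piFinset fun j => Finset.Icc 1 (l' j)).image
      fun lam => ∑ i, (lam i : ℤ) * a' i : Finset ℤ) := by
    rintro x ⟨lam, hlam, rfl⟩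
    rw [Finset.mem_coe]
    exact Finset.mem_image_of_mem _ (Fintype.mem_piFinset.2 fun i => Finset.mem_Icc.2 (hlam i))
  refine ⟨P, -∑ i ∈ I, ((L i : ℤ) + 1) * a i, ⟨a', l', fun j => ?_, rfl⟩,
    (Finset.finite_toSet _).subset hPsub, ?_, fun n hn => ?_⟩
  · by_cases hj : j ∈ Set.range f
    · obtain ⟨i, rfl⟩ := hj
      rw [hextl]; omega
    · rw [hnotl j hj]
  · refine (Set.ncard_le_ncard hPsub (Finset.finite_toSet _)).trans ?_
    rw [Set.ncard_coe_finset]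
    refine Finset.card_image_le.trans ?_
    rw [Fintype.card_piFinset]
    simp only [Nat.card_Icc, Nat.add_sub_cancel]
    rw [← Finset.prod_coe_sort I, Fintype.prod_of_injective f f.injective
      (fun i : I => 2 * L i + 1) l' hnotl fun i => (hextl i).symm]
  · set lam : Fin e → ℕ := Function.extend f (fun i => (n i + L i + 1).toNat) 1 with hlam
    have hlame : ∀ i, lam (f i) = (n i + L i + 1).toNat := fun i =>
      f.injective.extend_apply _ _ _
    have hlamn : ∀ j ∉ Set.range f, lam j = 1 := fun j hj => Function.extend_apply' _ _ _ hj
    refine ⟨∑ j, (lam j : ℤ) * a' j, ⟨lam, fun j => ?_, rfl⟩, ?_⟩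
    · by_cases hj : j ∈ Set.range f
      · obtain ⟨i, rfl⟩ := hj
        have := abs_le.1 (hn i i.2)
        rw [hextl, hlame]
        omega
      · rw [hlamn j hj, hnotl j hj]
        omega
    · rw [← Fintype.sum_of_injective f f.injective
        (fun i : I => (n i + L i + 1) * a i) (fun j => (lam j : ℤ) * a' j)
        (fun j hj => by rw [hnot j hj, mul_zero]) (fun i => by
          have := abs_le.1 (hn i i.2)
          rw [hext, hlame, Int.toNat_of_nonneg (by omega)]),
        Finset.sum_coe_sort I fun i => (n i + L i + 1) * a i, neg_add_eq_sub,
        ← Finset.sum_sub_distrib]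
      exact Finset.sum_congr rfl fun i _ => by ring

/-- Covering by translates of a GAP along the coordinates in `I`. -/
theorem exists_translates_isGAP_cover {M e : ℕ} {I : Finset (Fin M)} (hI : I.card ≤ e)
    (a : Fin M → ℤ) {L : Fin M → ℕ} {B : Finset (Fin M → ℤ)} (hB : B ⊆ intBox L) {A : Set ℤ}
    (hA : ∀ x ∈ A, ∃ n ∈ B, x = ∑ i, n i * a i) :
    ∃ X P : Set ℤ, X.Finite ∧ X.ncard ≤ (B.image (dropCoords I)).card ∧ IsGAP e P ∧ P.Finite ∧
      P.ncard ≤ ∏ i ∈ I, (2 * L i + 1) ∧ A ⊆ X + P := by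
  classical
  obtain ⟨P, c, hP, hPfin, hPcard, hPcov⟩ := exists_isGAP_cover hI a L
  refine ⟨((B.image (dropCoords I)).image fun v => ∑ i, v i * a i + c : Finset ℤ), P,
    Finset.finite_toSet _, ?_, hP, hPfin, hPcard, ?_⟩
  · rw [Set.ncard_coe_finset]
    exact Finset.card_image_le
  · intro x hx
    obtain ⟨n, hn, rfl⟩ := hA x hx
    obtain ⟨p, hp, hsum⟩ := hPcov n fun i _ => mem_intBox.1 (hB hn) i
    refine Set.mem_add.2 ⟨∑ i, dropCoords I n i * a i + c, ?_, p, hp, ?_⟩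
    · rw [Finset.mem_coe]
      exact Finset.mem_image_of_mem _ (Finset.mem_image_of_mem _ hn)
    · rw [add_assoc, ← hsum]
      have h : ∑ i ∈ I, n i * a i = ∑ i, if i ∈ I then n i * a i else 0 := by
        rw [Finset.sum_ite_mem, Finset.univ_inter]
      rw [h, ← Finset.sum_add_distrib]
      refine Finset.sum_congr rfl fun i _ => ?_
      rw [dropCoords_apply]
      split_ifs <;> simp

set_option maxHeartbeats 1000000 in
theorem stmt_2 (d l : ℕ)
    (hl : (l : ℝ) ≤ 0.1 * 2 ^ d ∨ ((l : ℝ) ≤ 0.315 * 2 ^ d ∧ 13 ≤ d)) :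
    ∃ t : ℕ, ∀ A : Set ℤ, A.Finite → A.Nonempty →
      2 ^ d * A.ncard ≤ (A + A).ncard → (A + A).ncard ≤ (2 ^ d + l) * A.ncard →
      NonDegenerate d t A →
      ∃ X P : Set ℤ, X.Finite ∧ X.ncard ≤ l + 1 ∧ IsGAP d P ∧
        P.ncard ≤ t * A.ncard ∧ A ⊆ X + P := by
  classical
  obtain ⟨M, C, hMC⟩ := freiman_proper (2 ^ d + l)
  obtain ⟨T, hT⟩ := exists_scale_gap
    (fun N => 100 * (((2 * N + 1) ^ M) ^ 2 * (M * 2 ^ M * C)) + 1) M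
  refine ⟨(2 * T + 1) ^ M * (C + 1), fun A hAfin hAne _ hdoub hnd => ?_⟩
  lift A to Finset ℤ using hAfin
  rw [← Finset.coe_add, Set.ncard_coe_finset, Set.ncard_coe_finset] at hdoub
  rw [Finset.coe_nonempty] at hAne
  obtain ⟨a, L, hcov, hprod, hproper⟩ := hMC A hAne hdoub
  choose! f hf using hcov
  have hfinj : Set.InjOn f A := by
    intro x hx y hy h
    rw [(hf x hx).2, (hf y hy).2, h]
  set B := A.image f with hB
  have hBcard : B.card = A.card := Finset.card_image_of_injOn hfinj
  have hBbox : B ⊆ intBox L := by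
    intro n hn
    obtain ⟨x, hx, rfl⟩ := Finset.mem_image.1 hn
    exact (hf x hx).1
  have hBB : (B + B).card ≤ (A + A).card := by
    refine Finset.card_le_card_of_injOn (fun n => ∑ i, n i * a i) ?_ ?_
    · intro n hn
      obtain ⟨u, hu, v, hv, rfl⟩ := Finset.mem_add.1 hn
      obtain ⟨x, hx, rfl⟩ := Finset.mem_image.1 hu
      obtain ⟨y, hy, rfl⟩ := Finset.mem_image.1 hv
      simp only [Pi.add_apply, add_mul, Finset.sum_add_distrib, ← (hf x hx).2, ← (hf y hy).2]
      exact Finset.add_mem_add hx hy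
    · intro n hn m hm h
      obtain ⟨u, hu, v, hv, rfl⟩ := Finset.mem_add.1 hn
      obtain ⟨u', hu', v', hv', rfl⟩ := Finset.mem_add.1 hm
      rw [← sub_eq_zero]
      refine hproper _ (fun i => ?_) ?_
      · have h1 := abs_le.1 (mem_intBox.1 (hBbox hu) i)
        have h2 := abs_le.1 (mem_intBox.1 (hBbox hv) i)
        have h3 := abs_le.1 (mem_intBox.1 (hBbox hu') i)
        have h4 := abs_le.1 (mem_intBox.1 (hBbox hv') i)
        simp only [Pi.sub_apply, Pi.add_apply]
        rw [abs_le]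
        constructor <;> linarith
      · simp only [Pi.sub_apply, sub_mul, Finset.sum_sub_distrib]
        exact sub_eq_zero.2 h
  obtain ⟨N, hNT, hN⟩ := hT L
  set R := ((2 * N + 1) ^ M) ^ 2 * (M * 2 ^ M * C) with hR
  set I := Finset.univ.filter fun i => 100 * R + 1 ≤ L i with hI
  have hID : ∀ i ∈ I, 100 * R + 1 ≤ L i := fun i hi => (Finset.mem_filter.1 hi).2
  have hIN : ∀ i ∉ I, L i ≤ N := by
    intro i hi
    refine (hN i).resolve_right fun h => hi ?_
    exact Finset.mem_filter.2 ⟨Finset.mem_univ _, h⟩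
  have hcardI : ∏ i ∈ I, (2 * L i + 1) ≤ C * A.card :=
    (Finset.prod_le_prod_of_subset_of_one_le' (Finset.subset_univ I)
      fun i _ _ => by omega).trans hprod
  have hX : (B.image (dropCoords I)).card ≤ (2 * N + 1) ^ M := by
    have h : B.image (dropCoords I) ⊆ intBox fun _ => N := by
      intro v hv
      obtain ⟨n, hn, rfl⟩ := Finset.mem_image.1 hv
      rw [mem_intBox]
      intro i
      rw [dropCoords_apply]
      split_ifs with hi
      · simp
      · exact (mem_intBox.1 (hBbox hn) i).trans (by exact_mod_cast hIN i hi)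
    have h2 := Finset.card_le_card h
    rwa [card_intBox, Finset.prod_const, Finset.card_univ, Fintype.card_fin] at h2
  have hXT : (B.image (dropCoords I)).card ≤ (2 * T + 1) ^ M :=
    hX.trans (Nat.pow_le_pow_left (by omega) M)
  have hAcov : ∀ x ∈ (A : Set ℤ), ∃ n ∈ B, x = ∑ i, n i * a i :=
    fun x hx => ⟨f x, Finset.mem_image_of_mem f hx, (hf x hx).2⟩
  have hTpos : 1 ≤ (2 * T + 1) ^ M := Nat.one_le_pow _ _ (by omega)
  have hdI : d ≤ I.card := by
    by_contra! hlt
    obtain ⟨X, P, hXfin, hXcard, hP, hPfin, hPcard, hsub⟩ :=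
      exists_translates_isGAP_cover (I := I) (e := d - 1) (by omega) a hBbox hAcov
    refine hnd ⟨X, P, hXfin, ?_, hP, hsub, ?_⟩
    · refine (hXcard.trans hXT).trans ?_
      exact Nat.le_mul_of_pos_right _ (by omega)
    · rw [Set.ncard_coe_finset]
      calc (X + P).ncard ≤ X.ncard * P.ncard := Set.natCard_add_le
        _ ≤ (2 * T + 1) ^ M * (C * A.card) :=
          Nat.mul_le_mul (hXcard.trans hXT) (hPcard.trans hcardI)
        _ ≤ (2 * T + 1) ^ M * ((C + 1) * A.card) := by gcongr; omega
        _ = _ := by ring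
  set E : ℝ := I.card * 2 ^ I.card * ((∏ i ∈ I, (2 * L i + 1) : ℕ) : ℝ) / ((100 * R + 1 : ℕ) : ℝ)
    with hE
  have hE0 : 0 ≤ E := by positivity
  obtain ⟨x₀, hx₀, hmax, hself, h₁, h₂⟩ := exists_max_fibre hBbox (hAne.image f)
    (Nat.succ_pos (100 * R)) hID hE.ge
  have hEbound : E * (B.image (dropCoords I)).card ^ 2 ≤ (B.card : ℝ) / 100 := by
    have hIM : I.card ≤ M := by simpa using Finset.card_le_univ I
    have h1 : I.card * 2 ^ I.card * (∏ i ∈ I, (2 * L i + 1)) *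
        (B.image (dropCoords I)).card ^ 2 ≤ R * B.card := by
      rw [hBcard, hR]
      calc _ ≤ M * 2 ^ M * (C * A.card) * ((2 * N + 1) ^ M) ^ 2 := by
            gcongr
            norm_num
        _ = _ := by ring
    have h2 : (I.card * 2 ^ I.card * ((∏ i ∈ I, (2 * L i + 1) : ℕ) : ℝ)) *
        (B.image (dropCoords I)).card ^ 2 ≤ R * B.card := by exact_mod_cast h1
    rw [hE, div_mul_eq_mul_div, div_le_iff₀ (by positivity)]
    push_cast at h2 ⊢
    nlinarith [(Nat.cast_nonneg B.card : (0 : ℝ) ≤ B.card)]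
  have hsum := sum_card_fib (π := dropCoords I) (A := B) (U := B.image (dropCoords I))
    fun n hn => Finset.mem_image_of_mem _ hn
  have hW : ((B + B).card : ℝ) ≤ (2 ^ d + l) * B.card := by
    rw [hBcard]
    exact_mod_cast hBB.trans hdoub
  have hBpos : (0 : ℝ) < B.card := by exact_mod_cast (hAne.image f).card_pos
  have hle : ((fib (dropCoords I) B x₀).card : ℝ) ≤ B.card := by
    exact_mod_cast Finset.card_le_card (Finset.filter_subset _ _)
  have hIcard : I.card = d := by
    refine le_antisymm ?_ hdI
    by_contra! hlt
    have hp : (2 : ℝ) ^ (d + 1) ≤ 2 ^ I.card := pow_le_pow_right₀ (by norm_num) hlt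
    have hp1 : (1 : ℝ) ≤ 2 ^ d := one_le_pow₀ (by norm_num)
    have hl' : (l : ℝ) ≤ 0.315 * 2 ^ d := by
      rcases hl with h | h
      · linarith
      · exact h.1
    have h3 : (2 : ℝ) ^ I.card * B.card ≤
        2 ^ I.card * (2 * B.card - (fib (dropCoords I) B x₀).card) :=
      mul_le_mul_of_nonneg_left (by linarith) (by positivity)
    rw [pow_succ] at hp
    nlinarith
  rw [hIcard] at hself h₁ h₂
  have hfib : (B.image (dropCoords I)).card ≤ l + 1 := by
    refine card_fibres_le hl hx₀ (f := fun x => ((fib (dropCoords I) B x).card : ℝ))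
      (fun x _ => by positivity) (by exact_mod_cast Finset.card_pos.2 (fib_nonempty hx₀))
      hself hE0 ?_ h₂ ?_ ?_
    · rw [hsum]; exact h₁
    · rw [hsum]; exact hW
    · rw [hsum]; exact hEbound
  obtain ⟨X, P, hXfin, hXcard, hP, hPfin, hPcard, hsub⟩ :=
    exists_translates_isGAP_cover hIcard.le a hBbox hAcov
  refine ⟨X, P, hXfin, hXcard.trans hfib, hP, ?_, hsub⟩
  rw [Set.ncard_coe_finset]
  calc P.ncard ≤ C * A.card := hPcard.trans hcardI
    _ ≤ (2 * T + 1) ^ M * (C + 1) * A.card := by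
      gcongr
      nlinarith
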